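/- For activated random walk on ℤ with simple symmetric nearest-neighbor jumps, there exist constants c > 0 and λ₀ ∈ (0,1) such that for all 0 < λ ≤ λ₀, ρ_c(ℤ, λ) ≥ c·√λ; that is, ρ_c(ℤ, λ) = Ω(√λ) as λ → 0. -/

import Mathlib

/-!
Common framework for the activated random walk (ARW) model on `ℤ^d`,
via the site-wise (Diaconis–Fulton) representation.
-/

open MeasureTheory ENNReal Filter

namespace ARW

noncomputable section
open scoped Classical

/-- A site of the lattice `ℤ^d`. -/
abbrev Site (d : ℕ) := Fin d → ℤ

/-- An instruction: `none` is a sleep instruction, `some z` is a jump instruction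
with displacement `z`. -/
abbrev Instr (d : ℕ) := Option (Site d)

instance (d : ℕ) : MeasurableSpace (Instr d) := ⊤

/-- The array of instruction stacks: `I (x, k)` is the `k`-th instruction at site `x`. -/
abbrev Stacks (d : ℕ) := Site d × ℕ → Instr d

/-- The state of a site: `active n` means `n` active particles (and no sleeping one),
`sleeping` means a single sleeping particle. -/
inductive SiteState : Type
  | active : ℕ → SiteState
  | sleeping : SiteState
  deriving DecidableEq

/-- A particle configuration. -/
abbrev Config (d : ℕ) := Site d → SiteState

/-- Number of active particles at a site state. -/
def numActive : SiteState → ℕ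
  | .active n => n
  | .sleeping => 0

/-- Adding one (active) particle to a site: a sleeping particle is reactivated. -/
def addParticle : SiteState → SiteState
  | .active n => .active (n + 1)
  | .sleeping => .active 2

/-- A state of the system: a configuration together with an odometer
(number of instructions already used at each site). -/
abbrev State (d : ℕ) := Config d × (Site d → ℕ)

/-- Initial state on `V` obtained from an all-active particle count `η` (particles
outside `V` are discarded), with odometer `0`. -/
def initState (d : ℕ) (V : Finset (Site d)) (η : Site d → ℕ) : State d :=
  (fun x => .active (if x ∈ V then η x else 0), fun _ => 0)

/-- Toppling the site `x` (inside `V`, particles jumping out of `V` are killed):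
the next unused instruction at `x` is executed and the odometer at `x` increases by one.
A sleep instruction puts the particle at `x` to sleep if it is alone (otherwise it has
no effect), and a jump instruction moves one particle from `x` to `x + z`
(reactivating a sleeping particle there), killing it if `x + z ∉ V`. -/
def topple {d : ℕ} (V : Finset (Site d)) (I : Stacks d) (x : Site d) (s : State d) :
    State d :=
  let σ := s.1
  let m := s.2
  let σ' : Config d :=
    match I (x, m x) with
    | none => if numActive (σ x) = 1 then Function.update σ x .sleeping else σ
    | some z =>
        let σ₁ := Function.update σ x (SiteState.active (numActive (σ x) - 1))
        if x + z ∈ V then Function.update σ₁ (x + z) (addParticle (σ₁ (x + z))) else σ₁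
  (σ', Function.update m x (m x + 1))

/-- Running a sequence of topplings. -/
def run {d : ℕ} (V : Finset (Site d)) (I : Stacks d) : State d → List (Site d) → State d
  | s, [] => s
  | s, x :: l => run V I (topple V I x s) l

/-- Legality of a toppling sequence: every toppled site lies in `V` and holds at least one
active particle when toppled. -/
def Legal {d : ℕ} (V : Finset (Site d)) (I : Stacks d) : State d → List (Site d) → Prop
  | _, [] => True
  | s, x :: l => x ∈ V ∧ 1 ≤ numActive (s.1 x) ∧ Legal V I (topple V I x s) l

/-- A configuration is stable in `V` if no site of `V` holds an active particle. -/
def Stable {d : ℕ} (V : Finset (Site d)) (σ : Config d) : Prop :=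
  ∀ x ∈ V, numActive (σ x) = 0

/-- The stabilization of `η` in `V` terminates. -/
def StabCompletes {d : ℕ} (V : Finset (Site d)) (I : Stacks d) (η : Site d → ℕ) : Prop :=
  ∃ l, Legal V I (initState d V η) l ∧ Stable V (run V I (initState d V η) l).1

/-- The stable configuration `Stab_V η` (well defined, independently of the chosen legal
toppling sequence, by the abelian property), when stabilization terminates. -/
def stabConfig {d : ℕ} (V : Finset (Site d)) (I : Stacks d) (η : Site d → ℕ) : Config d :=
  if h : StabCompletes V I η then (run V I (initState d V η) h.choose).1
  else fun _ => .active 0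

/-- The event `0 ∈ Stab_V η`: stabilization of `η` in `V` ends with a sleeping particle
at the origin. -/
def SleepAt0 {d : ℕ} (V : Finset (Site d)) (I : Stacks d) (η : Site d → ℕ) : Prop :=
  StabCompletes V I η ∧ stabConfig V I η 0 = .sleeping

/-- The event `0 ∉ Stab_V η`: stabilization of `η` in `V` ends with the origin empty. -/
def EmptyAt0 {d : ℕ} (V : Finset (Site d)) (I : Stacks d) (η : Site d → ℕ) : Prop :=
  StabCompletes V I η ∧ stabConfig V I η 0 ≠ .sleeping

/-- The limiting odometer of `η` at the origin: the supremum, over finite volumes `V` and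
legal toppling sequences in `V`, of the number of topplings performed at the origin. -/
def odom0 {d : ℕ} (I : Stacks d) (η : Site d → ℕ) : ℕ∞ :=
  ⨆ (V : Finset (Site d)) (l : List (Site d)) (_ : Legal V I (initState d V η) l),
    (l.count 0 : ℕ∞)

/-! ### The random instructions -/

/-- The normalized sleep rate `λ_s = λ/(1+λ)`. -/
def lamS (lam : ℝ) : ℝ := lam / (1 + lam)

/-- The normalized jump rate `λ_J = 1/(1+λ)`. -/
def lamJ (lam : ℝ) : ℝ := 1 / (1 + lam)

/-- The distribution of a single instruction: sleep with probability `λ_s`, jump by `z`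
with probability `λ_J · step z`. -/
def instrWeight {d : ℕ} (step : Site d → ℝ) (lam : ℝ) : Instr d → ℝ≥0∞
  | none => ENNReal.ofReal (lamS lam)
  | some z => ENNReal.ofReal (lamJ lam) * ENNReal.ofReal (step z)

/-- `μ` is the law of the i.i.d. instruction stacks: a probability measure whose
finite-dimensional cylinder probabilities are the products of the `instrWeight`s. -/
def IsStackLaw (d : ℕ) (step : Site d → ℝ) (lam : ℝ) (μ : Measure (Stacks d)) : Prop :=
  IsProbabilityMeasure μ ∧
    ∀ (F : Finset (Site d × ℕ)) (g : Site d × ℕ → Instr d),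
      μ {I | ∀ i ∈ F, I i = g i} = ∏ i ∈ F, instrWeight step lam (g i)

/-- The law of the i.i.d. instruction stacks (uniquely determined by its cylinder
probabilities; it exists whenever `step` is a probability distribution and `λ > 0`). -/
def stackLaw (d : ℕ) (step : Site d → ℝ) (lam : ℝ) : Measure (Stacks d) :=
  if h : ∃ μ, IsStackLaw d step lam μ then h.choose else 0

/-! ### Fixation and the critical density -/

/-- Translation of a particle count by `z`. -/
def shift {d : ℕ} (z : Site d) (η : Site d → ℕ) : Site d → ℕ := fun x => η (x + z)

/-- A translation-ergodic distribution of particles: invariant under all translations,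
and every translation-invariant event is trivial. -/
def IsTransErgodic {d : ℕ} (ν : Measure (Site d → ℕ)) : Prop :=
  (∀ z, Measure.map (shift z) ν = ν) ∧
    ∀ s : Set (Site d → ℕ), MeasurableSet s → (∀ z, shift z ⁻¹' s = s) → ν s = 0 ∨ ν s = 1

/-- Almost sure fixation of the initial distribution `ν`: for `ν`-almost every initial
configuration and almost every instructions, the limiting odometer at the origin is
finite (equivalently, by Amir–Gurel-Gurevich, every particle eventually sleeps forever). -/
def Fixates (d : ℕ) (step : Site d → ℝ) (lam : ℝ) (ν : Measure (Site d → ℕ)) : Prop :=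
  ∀ᵐ η ∂ν, ∀ᵐ I ∂(stackLaw d step lam), odom0 I η ≠ ⊤

/-- The critical density `ρ_c(ℤ^d, P, λ)`: the supremum of the densities `ρ` such that
every translation-ergodic probability distribution of active particles with mean `ρ`
particles per site fixates almost surely. -/
def critDensity (d : ℕ) (step : Site d → ℝ) (lam : ℝ) : ℝ :=
  sSup {ρ : ℝ | 0 ≤ ρ ∧
    ∀ ν : Measure (Site d → ℕ), IsProbabilityMeasure ν → IsTransErgodic ν →
      (∫⁻ η, (η 0 : ℝ≥0∞) ∂ν) = ENNReal.ofReal ρ → Fixates d step lam ν}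

/-! ### Random walk quantities -/

/-- Simple symmetric nearest-neighbour step distribution on `ℤ^d`. -/
def ssrwStep (d : ℕ) : Site d → ℝ :=
  fun z => if (∑ i, (z i).natAbs) = 1 then (1 : ℝ) / (2 * d) else 0

/-- `psum w k` : position after the first `k` steps with increments `w`. -/
def psum {d n : ℕ} (w : Fin n → Site d) (k : ℕ) : Site d :=
  ∑ i ∈ Finset.univ.filter (fun i : Fin n => (i : ℕ) < k), w i

/-- Probability of a given sequence of increments. -/
def pathProb {d n : ℕ} (step : Site d → ℝ) (w : Fin n → Site d) : ℝ := ∏ i, step (w i)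

/-- `P(S_n = 0)` for the discrete-time walk started at `0`. -/
def probAt0 {d : ℕ} (step : Site d → ℝ) (n : ℕ) : ℝ :=
  ∑' w : Fin n → Site d, if psum w n = 0 then pathProb step w else 0

/-- The Green's function `G = Σ_{n ≥ 0} P(S_n = 0)` of the walk, valued in `[0, ∞]`.
The walk is transient iff `greenE step < ∞`. -/
def greenE {d : ℕ} (step : Site d → ℝ) : ℝ≥0∞ :=
  ∑' n : ℕ, ENNReal.ofReal (probAt0 step n)

/-- Probability that the walk returns to `0` for the first time at time `n`, having
stayed inside `A` at all intermediate times. -/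
def returnIn {d : ℕ} (step : Site d → ℝ) (A : Set (Site d)) (n : ℕ) : ℝ :=
  ∑' w : Fin n → Site d,
    if (∀ k, 0 < k → k < n → psum w k ≠ 0 ∧ psum w k ∈ A) ∧ psum w n = 0
    then pathProb step w else 0

/-- `P(τ = n)` where `τ` is the first return time to the origin. -/
def firstReturn {d : ℕ} (step : Site d → ℝ) (n : ℕ) : ℝ := returnIn step Set.univ n

/-- The probability that the walk started at `0` exits `A` strictly before returning
to `0`. -/
def escProb {d : ℕ} (step : Site d → ℝ) (A : Set (Site d)) : ℝ :=
  ∑' n : ℕ, ∑' w : Fin (n + 1) → Site d,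
    if (∀ k, 0 < k → k ≤ n → psum w k ≠ 0 ∧ psum w k ∈ A) ∧ psum w (n + 1) ∉ A
    then pathProb step w else 0

/-- `q(ℤ^d, P, λ)`: the probability that a single particle started at the origin falls
asleep at the origin, i.e. that the walk is at `0` after `N` steps where
`P(N = n) = λ_s λ_J^n`. -/
def qProb {d : ℕ} (step : Site d → ℝ) (lam : ℝ) : ℝ :=
  ∑' n : ℕ, lamS lam * lamJ lam ^ n * probAt0 step n

/-- The ball `B_r = {x : ‖x‖₁ ≤ r}`. -/
def ball (d : ℕ) (r : ℝ) : Set (Site d) := {x | ((∑ i, (x i).natAbs : ℕ) : ℝ) ≤ r}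

/-- `η` fills `A`: at least one particle at each site of `A`. -/
def Fills {d : ℕ} (η : Site d → ℕ) (A : Set (Site d)) : Prop := ∀ x ∈ A, 1 ≤ η x

/-! ### Weak stabilization, strong stabilization and the number of chances -/

/-- Legality of a weak toppling sequence (with respect to the origin): off the origin as
usual, while the origin may only be toppled if it holds at least two active particles. -/
def WLegal {d : ℕ} (V : Finset (Site d)) (I : Stacks d) : State d → List (Site d) → Prop
  | _, [] => True
  | s, x :: l => x ∈ V ∧ (if x = 0 then 2 else 1) ≤ numActive (s.1 x) ∧
      WLegal V I (topple V I x s) l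

/-- Weak stability in `V` with respect to the origin. -/
def WStable {d : ℕ} (V : Finset (Site d)) (σ : Config d) : Prop :=
  numActive (σ 0) ≤ 1 ∧ ∀ x ∈ V, x ≠ 0 → numActive (σ x) = 0

/-- The weak stabilization of a state (well defined by the abelian property whenever it
terminates). -/
def weakStab {d : ℕ} (V : Finset (Site d)) (I : Stacks d) (s : State d) : State d :=
  if h : ∃ l, WLegal V I s l ∧ WStable V (run V I s l).1 then run V I s h.choose else s

/-- The jump-out step: the particle at the origin is acceptably toppled (consuming
instructions at the origin, ignoring the sleep instructions) until it jumps out. -/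
def jumpOut {d : ℕ} (V : Finset (Site d)) (I : Stacks d) (s : State d) : State d :=
  if h : ∃ k, (I (0, s.2 0 + k)).isSome then
    let k := Nat.find h
    let z := (I (0, s.2 0 + k)).get (Nat.find_spec h)
    let σ₁ := Function.update s.1 0 (SiteState.active (numActive (s.1 0) - 1))
    let σ' := if (0 : Site d) + z ∈ V then
        Function.update σ₁ ((0 : Site d) + z) (addParticle (σ₁ ((0 : Site d) + z)))
      else σ₁
    (σ', Function.update s.2 0 (s.2 0 + k + 1))
  else s

/-- The states of the strong stabilization of `η` on `V` with respect to the origin via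
successive weak stabilizations: `procState j` is the state after the `(j+1)`-st weak
stabilization; as long as the origin holds an active particle, it is jumped out and the
configuration is weakly stabilized again. -/
def procState {d : ℕ} (V : Finset (Site d)) (I : Stacks d) (η : Site d → ℕ) :
    ℕ → State d
  | 0 => weakStab V I (initState d V η)
  | j + 1 =>
      let s := procState V I η j
      if 1 ≤ numActive (s.1 0) then weakStab V I (jumpOut V I s) else s

/-- The number of chances `Ch(η, V)`: the number of completed iterations of the strong
stabilization procedure, i.e. the first `j` such that the origin is empty after the
`(j+1)`-st weak stabilization. -/
def chances {d : ℕ} (V : Finset (Site d)) (I : Stacks d) (η : Site d → ℕ) : ℕ∞ :=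
  if h : ∃ j, numActive ((procState V I η j).1 0) = 0 then (Nat.find h : ℕ∞) else ⊤

/-- The `j`-th weakly stable configuration `η^W_j` (for `1 ≤ j`). -/
def weakConfig {d : ℕ} (V : Finset (Site d)) (I : Stacks d) (η : Site d → ℕ) (j : ℕ) :
    Config d :=
  (procState V I η (j - 1)).1

/-- The `j`-th sleep trial `b_j` (for `1 ≤ j`): whether the first instruction used in the
`j`-th jump-out step is a sleep instruction. -/
def sleepTrial {d : ℕ} (V : Finset (Site d)) (I : Stacks d) (η : Site d → ℕ) (j : ℕ) :
    Prop :=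
  I (0, (procState V I η (j - 1)).2 0) = none

/-- `a^n` for `n ∈ ℕ∞`, with `a^∞ = 0` (appropriate for `a < 1`). -/
def enpow (a : ℝ≥0∞) : ℕ∞ → ℝ≥0∞
  | ⊤ => 0
  | (n : ℕ) => a ^ n

end
end ARW

open MeasureTheory ENNReal Filter Topology ARW

namespace ARWp

/-- one-dimensional site -/
def st (y : ℤ) : Site 1 := fun _ => y

lemma st_inj {a b : ℤ} : st a = st b ↔ a = b :=
  ⟨fun h => congrFun h 0, fun h => by rw [h]⟩

lemma st_eta (x : Site 1) : st (x 0) = x := by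
  funext i; rw [Subsingleton.elim i 0]; rfl

lemma st_add (y : ℤ) (z : Site 1) : st y + z = st (y + z 0) := by
  funext i; rw [Subsingleton.elim i 0]; rfl

/-- the integer-valued stacks -/
def Jof (I : Stacks 1) (y : ℤ) (k : ℕ) : Option ℤ := (I (st y, k)).map (fun z => z 0)

/-- only sleep and nearest-neighbour instructions -/
def NN (J : ℤ → ℕ → Option ℤ) : Prop :=
  ∀ y k, J y k = none ∨ J y k = some 1 ∨ J y k = some (-1)

/-- number of right jumps among the first `n` instructions at `y` -/
def cR (J : ℤ → ℕ → Option ℤ) (y : ℤ) (n : ℕ) : ℕ :=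
  ((Finset.range n).filter (fun k => J y k = some 1)).card

/-- number of left jumps among the first `n` instructions at `y` -/
def cL (J : ℤ → ℕ → Option ℤ) (y : ℤ) (n : ℕ) : ℕ :=
  ((Finset.range n).filter (fun k => J y k = some (-1))).card

lemma cR_succ (J : ℤ → ℕ → Option ℤ) (y : ℤ) (n : ℕ) :
    cR J y (n + 1) = cR J y n + if J y n = some 1 then 1 else 0 := by
  unfold cR
  rw [Finset.range_add_one, Finset.filter_insert]
  split_ifs with h
  · rw [Finset.card_insert_of_notMem (by simp)]
  · rfl

lemma cL_succ (J : ℤ → ℕ → Option ℤ) (y : ℤ) (n : ℕ) :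
    cL J y (n + 1) = cL J y n + if J y n = some (-1) then 1 else 0 := by
  unfold cL
  rw [Finset.range_add_one, Finset.filter_insert]
  split_ifs with h
  · rw [Finset.card_insert_of_notMem (by simp)]
  · rfl

lemma cR_mono (J : ℤ → ℕ → Option ℤ) (y : ℤ) {m n : ℕ} (h : m ≤ n) : cR J y m ≤ cR J y n :=
  Finset.card_le_card (Finset.filter_subset_filter _ (Finset.range_mono h))

lemma cL_mono (J : ℤ → ℕ → Option ℤ) (y : ℤ) {m n : ℕ} (h : m ≤ n) : cL J y m ≤ cL J y n :=
  Finset.card_le_card (Finset.filter_subset_filter _ (Finset.range_mono h))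

lemma cR_le (J : ℤ → ℕ → Option ℤ) (y : ℤ) (n : ℕ) : cR J y n ≤ n := by
  unfold cR
  exact (Finset.card_filter_le _ _).trans (by simp)

lemma cL_le (J : ℤ → ℕ → Option ℤ) (y : ℤ) (n : ℕ) : cL J y n ≤ n := by
  unfold cL
  exact (Finset.card_filter_le _ _).trans (by simp)

lemma cR_zero (J : ℤ → ℕ → Option ℤ) (y : ℤ) : cR J y 0 = 0 := rfl
lemma cL_zero (J : ℤ → ℕ → Option ℤ) (y : ℤ) : cL J y 0 = 0 := rfl

lemma cRL_le (J : ℤ → ℕ → Option ℤ) (y : ℤ) (n : ℕ) : cR J y n + cL J y n ≤ n := by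
  induction n with
  | zero => simp [cR_zero, cL_zero]
  | succ n ih =>
    rw [cR_succ, cL_succ]
    by_cases h : J y n = some 1
    · simp [h]; omega
    · simp only [h, if_false]; split_ifs <;> omega

/-- net number of particles at `y` for the odometer `u` -/
def Hh (J : ℤ → ℕ → Option ℤ) (η : ℤ → ℕ) (u : ℤ → ℕ) (y : ℤ) : ℤ :=
  (η y : ℤ) + cR J (y - 1) (u (y - 1)) + cL J (y + 1) (u (y + 1)) - cR J y (u y) - cL J y (u y)

lemma Hh_none {J : ℤ → ℕ → Option ℤ} {η : ℤ → ℕ} {u : ℤ → ℕ} {w : ℤ} (h : J w (u w) = none)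
    (y : ℤ) : Hh J η (Function.update u w (u w + 1)) y = Hh J η u y := by
  have h1 : ∀ z, cR J z (Function.update u w (u w + 1) z) = cR J z (u z) := by
    intro z
    by_cases hz : z = w
    · subst hz; simp [cR_succ, h]
    · simp [hz]
  have h2 : ∀ z, cL J z (Function.update u w (u w + 1) z) = cL J z (u z) := by
    intro z
    by_cases hz : z = w
    · subst hz; simp [cL_succ, h]
    · simp [hz]
  simp only [Hh, h1, h2]

lemma Hh_right {J : ℤ → ℕ → Option ℤ} {η : ℤ → ℕ} {u : ℤ → ℕ} {w : ℤ} (h : J w (u w) = some 1)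
    (y : ℤ) : Hh J η (Function.update u w (u w + 1)) y =
      Hh J η u y - (if y = w then 1 else 0) + (if y = w + 1 then 1 else 0) := by
  have h1 : ∀ z, (cR J z (Function.update u w (u w + 1) z) : ℤ)
      = cR J z (u z) + if z = w then 1 else 0 := by
    intro z
    by_cases hz : z = w
    · subst hz; simp [cR_succ, h]
    · simp [hz]
  have h2 : ∀ z, cL J z (Function.update u w (u w + 1) z) = cL J z (u z) := by
    intro z
    by_cases hz : z = w
    · subst hz; simp [cL_succ, h]
    · simp [hz]
  simp only [Hh, h1, h2]
  have : (y - 1 = w) ↔ (y = w + 1) := by omega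
  simp only [this]
  ring

lemma Hh_left {J : ℤ → ℕ → Option ℤ} {η : ℤ → ℕ} {u : ℤ → ℕ} {w : ℤ}
    (h : J w (u w) = some (-1))
    (y : ℤ) : Hh J η (Function.update u w (u w + 1)) y =
      Hh J η u y - (if y = w then 1 else 0) + (if y = w + -1 then 1 else 0) := by
  have h1 : ∀ z, (cL J z (Function.update u w (u w + 1) z) : ℤ)
      = cL J z (u z) + if z = w then 1 else 0 := by
    intro z
    by_cases hz : z = w
    · subst hz; simp [cL_succ, h]
    · simp [hz]
  have h2 : ∀ z, cR J z (Function.update u w (u w + 1) z) = cR J z (u z) := by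
    intro z
    by_cases hz : z = w
    · subst hz; simp [cR_succ, h]
    · simp [hz]
  simp only [Hh, h1, h2]
  have : (y + 1 = w) ↔ (y = w + -1) := by omega
  simp only [this]
  ring

lemma Hh_jump {J : ℤ → ℕ → Option ℤ} (hJ : NN J) {η : ℤ → ℕ} {u : ℤ → ℕ} {w z : ℤ}
    (h : J w (u w) = some z)
    (y : ℤ) : Hh J η (Function.update u w (u w + 1)) y =
      Hh J η u y - (if y = w then 1 else 0) + (if y = w + z then 1 else 0) := by
  rcases hJ w (u w) with h' | h' | h'
  · simp [h'] at h
  · rw [h'] at h; simp at h; subst h; exact Hh_right h' y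
  · rw [h'] at h; simp at h; subst h; exact Hh_left h' y

lemma Hh_mono {J : ℤ → ℕ → Option ℤ} {η : ℤ → ℕ} {u m : ℤ → ℕ} {w : ℤ}
    (hle : ∀ y, m y ≤ u y) (hw : m w = u w) : Hh J η m w ≤ Hh J η u w := by
  have h1 := cR_mono J (w - 1) (hle (w - 1))
  have h2 := cL_mono J (w + 1) (hle (w + 1))
  simp only [Hh, hw]
  omega

/-- number of particles -/
def cnt : SiteState → ℕ
  | .active n => n
  | .sleeping => 1

lemma numActive_le_cnt (a : SiteState) : numActive a ≤ cnt a := by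
  cases a <;> simp [numActive, cnt]

lemma cnt_addParticle (a : SiteState) : cnt (addParticle a) = cnt a + 1 := by
  cases a <;> simp [addParticle, cnt]

lemma cnt_eq_of_pos {a : SiteState} (h : 1 ≤ numActive a) : a = .active (numActive a) := by
  cases a <;> simp_all [numActive]

lemma numActive_of_two {a : SiteState} (h : 2 ≤ cnt a) : numActive a = cnt a := by
  cases a <;> simp_all [numActive, cnt]

/-- invariant satisfied along legal topplings -/
structure LInv (V : Finset (Site 1)) (I : Stacks 1) (η : Site 1 → ℕ) (s : State 1) : Prop where
  out : ∀ y, st y ∉ V → s.2 (st y) = 0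
  mass : ∀ y, st y ∈ V → (cnt (s.1 (st y)) : ℤ) =
    Hh (Jof I) (fun z => η (st z)) (fun z => s.2 (st z)) y
  slp : ∀ y, st y ∈ V → ∀ k, s.2 (st y) = k + 1 → Jof I y k = none →
    1 ≤ cnt (s.1 (st y)) ∧ (cnt (s.1 (st y)) = 1 → numActive (s.1 (st y)) = 0)

lemma LInv_init (V : Finset (Site 1)) (I : Stacks 1) (η : Site 1 → ℕ) :
    LInv V I η (initState 1 V η) where
  out := by intro y _; rfl
  mass := by
    intro y hy
    simp [initState, cnt, Hh, hy, cR_zero, cL_zero]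
  slp := by intro y _ k h; simp [initState] at h

lemma upd_st (m : Site 1 → ℕ) (w : ℤ) (v : ℕ) :
    (fun z => Function.update m (st w) v (st z)) = Function.update (fun z => m (st z)) w v := by
  funext z
  by_cases hz : z = w
  · subst hz; simp
  · have : st z ≠ st w := fun h => hz (st_inj.1 h)
    simp [hz, this]

lemma LInv_topple {V : Finset (Site 1)} {I : Stacks 1} {η : Site 1 → ℕ} {s : State 1}
    (hN : NN (Jof I)) (h : LInv V I η s) {w : ℤ} (hw : st w ∈ V)
    (ha : 1 ≤ numActive (s.1 (st w))) : LInv V I η (topple V I (st w) s) := by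
  have hca := cnt_eq_of_pos ha
  have hcw : cnt (s.1 (st w)) = numActive (s.1 (st w)) := by rw [hca]; rfl
  have hne : ∀ y, y ≠ w → st y ≠ st w := fun y hy h => hy (st_inj.1 h)
  cases hI : I (st w, s.2 (st w)) with
  | none =>
    have hJ : Jof I w (s.2 (st w)) = none := by simp [Jof, hI]
    have ht : topple V I (st w) s = (if numActive (s.1 (st w)) = 1 then
        Function.update s.1 (st w) .sleeping else s.1,
        Function.update s.2 (st w) (s.2 (st w) + 1)) := by
      simp [topple, hI]
    have hc : ∀ y, cnt ((topple V I (st w) s).1 (st y)) = cnt (s.1 (st y)) := by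
      intro y
      rw [ht]
      by_cases hy : y = w
      · subst hy
        dsimp only
        split_ifs with h1
        · simp only [Function.update_self]; rw [hcw, h1]; rfl
        · rfl
      · dsimp only
        split_ifs with h1
        · simp [hne y hy]
        · rfl
    refine ⟨?_, ?_, ?_⟩
    · intro y hy
      have : y ≠ w := by rintro rfl; exact hy hw
      rw [ht]; simp [hne y this, h.out y hy]
    · intro y hy
      rw [hc, h.mass y hy, ht]
      dsimp only
      rw [upd_st]
      exact (Hh_none (u := fun z => s.2 (st z)) hJ y).symm
    · intro y hy k hk hkn
      rw [hc]
      by_cases hyw : y = w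
      · subst hyw
        refine ⟨by omega, fun h1 => ?_⟩
        rw [ht]; rw [hcw] at h1
        dsimp only
        rw [if_pos h1, Function.update_self]
        rfl
      · rw [ht] at hk ⊢
        have := hne y hyw
        simp [this] at hk
        have h2 := h.slp y hy k hk hkn
        refine ⟨h2.1, fun h1 => ?_⟩
        dsimp only
        split_ifs
        · simp [this, h2.2 h1]
        · exact h2.2 h1
  | some z =>
    have hJ : Jof I w (s.2 (st w)) = some (z 0) := by simp [Jof, hI]
    have hz0 : z 0 ≠ 0 := by
      rcases hN w (s.2 (st w)) with h' | h' | h' <;> rw [hJ] at h' <;> simp at h' <;> omega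
    have hwz : st w + z ≠ st w := by
      rw [st_add]; exact hne _ (by omega)
    have ht : topple V I (st w) s = (if st w + z ∈ V then
        Function.update (Function.update s.1 (st w) (SiteState.active (numActive (s.1 (st w)) - 1)))
          (st w + z) (addParticle (s.1 (st w + z))) else
        Function.update s.1 (st w) (SiteState.active (numActive (s.1 (st w)) - 1)),
        Function.update s.2 (st w) (s.2 (st w) + 1)) := by
      simp [topple, hI, hwz]
    have hself : (topple V I (st w) s).1 (st w) = .active (numActive (s.1 (st w)) - 1) := by
      rw [ht]; dsimp only; split_ifs <;> simp [hwz.symm]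
    have htgt : st w + z ∈ V → (topple V I (st w) s).1 (st w + z) = addParticle (s.1 (st w + z)) := by
      intro h1; rw [ht]; simp [h1]
    have hoth : ∀ y, y ≠ w → y ≠ w + z 0 → (topple V I (st w) s).1 (st y) = s.1 (st y) := by
      intro y h1 h2
      have h3 : st y ≠ st w + z := by rw [st_add]; exact fun h => h2 (st_inj.1 h)
      rw [ht]; dsimp only; split_ifs <;> simp [hne y h1, h3]
    have hm : (topple V I (st w) s).2 = Function.update s.2 (st w) (s.2 (st w) + 1) := by rw [ht]
    refine ⟨?_, ?_, ?_⟩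
    · intro y hy
      have : y ≠ w := by rintro rfl; exact hy hw
      rw [hm]; simp [hne y this, h.out y hy]
    · intro y hy
      rw [hm, upd_st]
      rw [Hh_jump (u := fun z => s.2 (st z)) hN hJ y, ← h.mass y hy]
      by_cases h1 : y = w
      · subst h1
        rw [hself, hcw]
        have : y ≠ y + z 0 := by omega
        simp only [cnt, if_true, if_neg this]; omega
      · by_cases h2 : y = w + z 0
        · have e : st y = st w + z := by rw [st_add, h2]
          have e2 := htgt (e ▸ hy)
          rw [← e] at e2
          rw [e2, cnt_addParticle]
          simp [h1, h2, hz0]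
        · rw [hoth y h1 h2]; simp [h1, h2]
    · intro y hy k hk hkn
      rw [hm] at hk
      by_cases h1 : y = w
      · subst h1
        simp at hk; subst hk
        rw [hJ] at hkn; simp at hkn
      · simp [hne y h1] at hk
        have h3 := h.slp y hy k hk hkn
        by_cases h2 : y = w + z 0
        · have e : st y = st w + z := by rw [st_add, h2]
          have e2 := htgt (e ▸ hy)
          rw [← e] at e2
          rw [e2, cnt_addParticle]
          omega
        · rw [hoth y h1 h2]; exact h3

lemma topple_snd (V : Finset (Site 1)) (I : Stacks 1) (x : Site 1) (s : State 1) :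
    (topple V I x s).2 = Function.update s.2 x (s.2 x + 1) := rfl

lemma run_snd (V : Finset (Site 1)) (I : Stacks 1) (l : List (Site 1)) (s : State 1)
    (x : Site 1) : (run V I s l).2 x = s.2 x + l.count x := by
  induction l generalizing s with
  | nil => simp [run]
  | cons a l ih =>
    rw [run, ih, topple_snd]
    by_cases h : a = x
    · subst h; simp; omega
    · simp [Ne.symm h, h]

lemma LInv_run {V : Finset (Site 1)} {I : Stacks 1} {η : Site 1 → ℕ} (hN : NN (Jof I))
    (l : List (Site 1)) (s : State 1) (h : LInv V I η s) (hl : Legal V I s l) :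
    LInv V I η (run V I s l) := by
  induction l generalizing s with
  | nil => exact h
  | cons a l ih =>
    obtain ⟨h1, h2, h3⟩ := hl
    rw [← st_eta a] at h1 h2
    have := LInv_topple hN h h1 h2
    rw [st_eta] at this
    exact ih _ this h3

lemma least_action {V : Finset (Site 1)} {I : Stacks 1} {η : Site 1 → ℕ} (hN : NN (Jof I))
    (u : ℤ → ℕ)
    (hu : ∀ y, st y ∈ V → Hh (Jof I) (fun z => η (st z)) u y ≤ 0 ∨
      (Hh (Jof I) (fun z => η (st z)) u y = 1 ∧ ∃ k, u y = k + 1 ∧ Jof I y k = none))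
    (l : List (Site 1)) (s : State 1) (h : LInv V I η s) (hl : Legal V I s l)
    (hs : ∀ y, s.2 (st y) ≤ u y) : ∀ y, (run V I s l).2 (st y) ≤ u y := by
  induction l generalizing s with
  | nil => exact hs
  | cons a l ih =>
    obtain ⟨h1, h2, h3⟩ := hl
    rw [← st_eta a] at h1 h2
    have h4 := LInv_topple hN h h1 h2
    rw [st_eta] at h4
    refine ih _ h4 h3 ?_
    have key : s.2 (st (a 0)) < u (a 0) := by
      by_contra hcon
      have heq : s.2 (st (a 0)) = u (a 0) := le_antisymm (hs _) (not_lt.1 hcon)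
      have hle := Hh_mono (J := Jof I) (η := fun z => η (st z)) (m := fun z => s.2 (st z)) hs heq
      rw [← h.mass _ h1] at hle
      have hc := numActive_le_cnt (s.1 (st (a 0)))
      rcases hu _ h1 with h5 | ⟨h5, k, hk, hk2⟩
      · omega
      · have := h.slp _ h1 k (by rw [heq, hk]) hk2
        have := this.2 (by omega)
        omega
    intro y
    rw [topple_snd]
    by_cases hy : y = a 0
    · subst hy
      rw [st_eta] at key ⊢
      simp; omega
    · have : st y ≠ a := by rw [← st_eta a]; exact fun h => hy (st_inj.1 h)
      simp [this, hs y]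

/-! ### odometers at general sites, monotonicity -/

noncomputable def odomAt (x : ℤ) (I : Stacks 1) (η : Site 1 → ℕ) : ℕ∞ :=
  ⨆ (V : Finset (Site 1)) (l : List (Site 1)) (_ : Legal V I (initState 1 V η) l),
    (l.count (st x) : ℕ∞)

lemma odomAt_zero (I : Stacks 1) (η : Site 1 → ℕ) : odomAt 0 I η = odom0 I η := rfl

lemma le_odomAt {x : ℤ} {I : Stacks 1} {η : Site 1 → ℕ} {V : Finset (Site 1)}
    {l : List (Site 1)} (h : Legal V I (initState 1 V η) l) :
    (l.count (st x) : ℕ∞) ≤ odomAt x I η :=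
  le_iSup_of_le V (le_iSup_of_le l (le_iSup_of_le h le_rfl))

lemma le_odomAt_iff {x : ℤ} {I : Stacks 1} {η : Site 1 → ℕ} {n : ℕ} (hn : 1 ≤ n) :
    (n : ℕ∞) ≤ odomAt x I η ↔ ∃ V l, Legal V I (initState 1 V η) l ∧ n ≤ l.count (st x) := by
  constructor
  · intro h
    have : ((n - 1 : ℕ) : ℕ∞) < odomAt x I η := by
      refine lt_of_lt_of_le ?_ h
      exact_mod_cast (by omega : n - 1 < n)
    unfold odomAt at this
    simp only [lt_iSup_iff] at this
    obtain ⟨V, l, hl, h2⟩ := this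
    have : n - 1 < l.count (st x) := by exact_mod_cast h2
    exact ⟨V, l, hl, by omega⟩
  · rintro ⟨V, l, hl, h2⟩
    exact le_trans (by exact_mod_cast h2) (le_odomAt hl)

lemma odomAt_top_iff {x : ℤ} {I : Stacks 1} {η : Site 1 → ℕ} :
    odomAt x I η = ⊤ ↔ ∀ n : ℕ, ∃ V l, Legal V I (initState 1 V η) l ∧ n ≤ l.count (st x) := by
  constructor
  · intro h n
    obtain ⟨V, l, hl, h2⟩ := (le_odomAt_iff (x := x) (I := I) (η := η) (n := n + 1) (by omega)).1
      (by rw [h]; exact le_top)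
    exact ⟨V, l, hl, by omega⟩
  · intro h
    refine ENat.eq_top_iff_forall_ge.2 fun n => ?_
    obtain ⟨V, l, hl, h2⟩ := h n
    exact le_trans (by exact_mod_cast h2) (le_odomAt hl)

/-- rank of a site state -/
def rk : SiteState → ℕ
  | .active 0 => 0
  | .sleeping => 1
  | .active (n + 1) => n + 2

lemma rk_numActive {a b : SiteState} (h : rk a ≤ rk b) : numActive a ≤ numActive b := by
  rcases a with (_ | n) | _ <;> rcases b with (_ | m) | _ <;> simp_all [rk, numActive]

lemma rk_add {a b : SiteState} (h : rk a ≤ rk b) : rk (addParticle a) ≤ rk (addParticle b) := by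
  rcases a with (_ | n) | _ <;> rcases b with (_ | m) | _ <;> simp_all [rk, addParticle]

lemma rk_le_add (a : SiteState) : rk a ≤ rk (addParticle a) := by
  rcases a with (_ | n) | _ <;> simp_all [rk, addParticle]

lemma rk_active {n m : ℕ} (h : n ≤ m) : rk (.active n) ≤ rk (.active m) := by
  rcases n with _ | n <;> rcases m with _ | m <;> simp_all [rk]

lemma rk_topple {V V' : Finset (Site 1)} (hV : V ⊆ V') {I : Stacks 1} {s s' : State 1}
    (hN : NN (Jof I))
    (h2 : s.2 = s'.2) (h1 : ∀ x, rk (s.1 x) ≤ rk (s'.1 x)) (x : Site 1)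
    (ha : 1 ≤ numActive (s.1 x)) (y : Site 1) :
    rk ((topple V I x s).1 y) ≤ rk ((topple V' I x s').1 y) := by
  have hn := rk_numActive (h1 x)
  cases hI : I (x, s.2 x) with
  | none =>
    simp only [topple, hI, ← h2]
    by_cases hy : y = x
    · subst hy
      by_cases e1 : numActive (s.1 y) = 1 <;> by_cases e2 : numActive (s'.1 y) = 1
      · simp [e1, e2]
      · simp only [e1, e2, if_true, if_false, Function.update_self]
        rw [cnt_eq_of_pos (ha.trans hn)]
        obtain ⟨k, hk⟩ : ∃ k, numActive (s'.1 y) = k + 1 := ⟨numActive (s'.1 y) - 1, by omega⟩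
        rw [hk]; simp [rk]
      · omega
      · simp [e1, e2, h1]
    · by_cases e1 : numActive (s.1 x) = 1 <;> by_cases e2 : numActive (s'.1 x) = 1 <;>
        simp [e1, e2, hy, h1]
  | some z =>
    have hz0 : z 0 ≠ 0 := by
      have hJ : Jof I (x 0) (s.2 x) = some (z 0) := by simp [Jof, st_eta, hI]
      rcases hN (x 0) (s.2 x) with h' | h' | h' <;> rw [hJ] at h' <;> simp at h' <;> omega
    have hwz : x + z ≠ x := by
      intro h; apply hz0; have := congrFun h 0; simpa using this
    simp only [topple, hI, ← h2]
    by_cases hy : y = x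
    · subst hy
      have : rk (SiteState.active (numActive (s.1 y) - 1)) ≤
        rk (SiteState.active (numActive (s'.1 y) - 1)) := rk_active (by omega)
      split_ifs <;> simp [hwz.symm, this]
    · by_cases hyz : y = x + z
      · subst hyz
        by_cases e1 : x + z ∈ V
        · simp [e1, hV e1, hwz, rk_add (h1 _)]
        · by_cases e2 : x + z ∈ V'
          · simp only [e1, e2, if_true, if_false, Function.update_self,
              Function.update_of_ne hwz]
            exact (h1 _).trans (rk_le_add _)
          · simp [e1, e2, hwz, h1]
      · split_ifs <;> simp [hy, hyz, h1]

lemma legal_mono {V V' : Finset (Site 1)} (hV : V ⊆ V') {I : Stacks 1} (hN : NN (Jof I))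
    (l : List (Site 1)) {s s' : State 1}
    (h2 : s.2 = s'.2) (h1 : ∀ x, rk (s.1 x) ≤ rk (s'.1 x)) (hl : Legal V I s l) :
    Legal V' I s' l := by
  induction l generalizing s s' with
  | nil => trivial
  | cons a l ih =>
    obtain ⟨e1, e2, e3⟩ := hl
    refine ⟨hV e1, e2.trans (rk_numActive (h1 a)), ih ?_ ?_ e3⟩
    · rw [topple_snd, topple_snd, h2]
    · exact fun y => rk_topple hV hN h2 h1 a e2 y

lemma legal_init_mono {V V' : Finset (Site 1)} (hV : V ⊆ V') {I : Stacks 1} (hN : NN (Jof I))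
    {l : List (Site 1)} {η : Site 1 → ℕ} (hl : Legal V I (initState 1 V η) l) :
    Legal V' I (initState 1 V' η) l := by
  refine legal_mono (s := initState 1 V η) (s' := initState 1 V' η) hV hN l rfl ?_ hl
  intro x
  simp only [initState]
  refine rk_active ?_
  by_cases h : x ∈ V
  · simp [h, hV h]
  · simp [h]

lemma legal_append {V : Finset (Site 1)} {I : Stacks 1} (l l' : List (Site 1)) (s : State 1) :
    Legal V I s (l ++ l') ↔ Legal V I s l ∧ Legal V I (run V I s l) l' := by
  induction l generalizing s with
  | nil => simp [Legal, run]
  | cons a l ih => simp [Legal, run, ih, and_assoc]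

/-! ### propagation -/

lemma odom_propagate {I : Stacks 1} {η : Site 1 → ℕ} (hN : NN (Jof I)) (x y : ℤ)
    (hin : ∀ N : ℕ, ∃ n, ∀ m : ℤ → ℕ, n ≤ m x →
      (N : ℤ) ≤ Hh (Jof I) (fun z => η (st z)) m y + m y)
    (h : odomAt x I η = ⊤) : odomAt y I η = ⊤ := by
  rw [odomAt_top_iff] at h ⊢
  intro N
  by_contra hcon
  push Not at hcon
  obtain ⟨n, hn⟩ := hin (N + 2)
  obtain ⟨V, l, hl, hlc⟩ := h n
  have hl' : Legal (insert (st y) V) I (initState 1 (insert (st y) V) η) l :=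
    legal_init_mono (Finset.subset_insert _ _) hN hl
  set V' := insert (st y) V
  have hyV : st y ∈ V' := Finset.mem_insert_self _ _
  -- topple `y` repeatedly
  have key : ∀ j, j ≤ N → Legal V' I (initState 1 V' η) (l ++ List.replicate j (st y)) := by
    intro j
    induction j with
    | zero => intro _; simpa using hl'
    | succ j ih =>
      intro hj
      have h1 := ih (by omega)
      have h2 := hcon V' _ h1
      have e : l ++ List.replicate (j + 1) (st y)
          = (l ++ List.replicate j (st y)) ++ [st y] := by
        rw [List.replicate_succ', List.append_assoc]
      rw [e, legal_append]
      refine ⟨h1, hyV, ?_, trivial⟩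
      have inv := LInv_run hN _ _ (LInv_init V' I η) h1
      have hm := inv.mass y hyV
      have hx := hn (fun z => (run V' I (initState 1 V' η) (l ++ List.replicate j (st y))).2 (st z))
        (by
          rw [run_snd]
          have : (l ++ List.replicate j (st y)).count (st x) ≥ l.count (st x) := by
            rw [List.count_append]; omega
          omega)
      rw [← hm] at hx
      have h3 := run_snd V' I (l ++ List.replicate j (st y)) (initState 1 V' η) (st y)
      have h4 : (initState 1 V' η).2 (st y) = 0 := rfl
      have h5 : 2 ≤ cnt ((run V' I (initState 1 V' η) (l ++ List.replicate j (st y))).1 (st y)) := by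
        push_cast at hx
        omega
      rw [numActive_of_two h5]; omega
  have := hcon V' _ (key N le_rfl)
  simp at this

/-- every site has infinitely many right and left jump instructions -/
def Rich (J : ℤ → ℕ → Option ℤ) : Prop :=
  ∀ y, (∀ N, ∃ n, N ≤ cR J y n) ∧ (∀ N, ∃ n, N ≤ cL J y n)

lemma odom_right {I : Stacks 1} {η : Site 1 → ℕ} (hN : NN (Jof I)) (hR : Rich (Jof I)) (x : ℤ)
    (h : odomAt x I η = ⊤) : odomAt (x + 1) I η = ⊤ := by
  refine odom_propagate hN x (x + 1) (fun N => ?_) h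
  obtain ⟨n, hn⟩ := (hR x).1 N
  refine ⟨n, fun m hm => ?_⟩
  have h1 := cR_mono (Jof I) x hm
  have h2 := cRL_le (Jof I) (x + 1) (m (x + 1))
  simp only [Hh, add_sub_cancel_right]
  omega

lemma odom_left {I : Stacks 1} {η : Site 1 → ℕ} (hN : NN (Jof I)) (hR : Rich (Jof I)) (x : ℤ)
    (h : odomAt x I η = ⊤) : odomAt (x - 1) I η = ⊤ := by
  refine odom_propagate hN x (x - 1) (fun N => ?_) h
  obtain ⟨n, hn⟩ := (hR x).2 N
  refine ⟨n, fun m hm => ?_⟩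
  have h1 := cL_mono (Jof I) x hm
  have h2 := cRL_le (Jof I) (x - 1) (m (x - 1))
  simp only [Hh, sub_add_cancel]
  omega

lemma odom_all {I : Stacks 1} {η : Site 1 → ℕ} (hN : NN (Jof I)) (hR : Rich (Jof I)) (x y : ℤ)
    (h : odomAt x I η = ⊤) : odomAt y I η = ⊤ := by
  have h1 : ∀ n : ℕ, odomAt (x + n) I η = ⊤ := by
    intro n
    induction n with
    | zero => simpa using h
    | succ n ih => have := odom_right hN hR _ ih; push_cast; rwa [← add_assoc]
  have h2 : ∀ n : ℕ, odomAt (x - n) I η = ⊤ := by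
    intro n
    induction n with
    | zero => simpa using h
    | succ n ih => have := odom_left hN hR _ ih; push_cast; rwa [← sub_sub]
  rcases le_total x y with hxy | hxy
  · have := h1 (y - x).toNat
    rwa [Int.toNat_of_nonneg (by omega), add_sub_cancel] at this
  · have := h2 (x - y).toNat
    have e : x - (x - y) = y := by omega
    rwa [Int.toNat_of_nonneg (by omega), e] at this

end ARWp
namespace ARWp

/-! ### The trap exploration -/

/-- state of the exploration while a particle is walking -/
structure TS where
  a : ℤ
  x : ℤ
  M : ℤ
  x0 : ℤ
  u : ℤ → ℕ
  r : ℤ → ℕ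
  xs : List ℤ

/-- phases of the exploration -/
inductive Ph : Type
  | run : TS → Ph
  | done : (ℤ → ℕ) → Ph
  | fail : Ph

def start (a : ℤ) (u : ℤ → ℕ) : List ℤ → Ph
  | [] => .done u
  | x :: xs => .run ⟨a, x, x, x, u, u, xs⟩

/-- the updated odometer -/
def TS.r' (s : TS) : ℤ → ℕ := Function.update s.r s.x (s.r s.x + 1)

def stp (L : ℤ) (s : TS) : Option ℤ → Ph
  | none => .run ⟨s.a, s.x, s.x, s.x0, s.r', s.r', s.xs⟩
  | some z =>
    if s.x + z = s.a then (if s.M < s.x0 then start s.M s.u s.xs else .fail)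
    else if L < s.x + z then start s.a s.r' s.xs
    else .run ⟨s.a, s.x + z, max s.M (s.x + z), s.x0, s.u, s.r', s.xs⟩

def runN (L : ℤ) (J : ℤ → ℕ → Option ℤ) : ℕ → Ph → Ph
  | 0, φ => φ
  | n + 1, .run s => runN L J n (stp L s (J s.x (s.r s.x)))
  | _ + 1, .done u => .done u
  | _ + 1, .fail => .fail

def isDone : Ph → Prop
  | .done _ => True
  | _ => False

/-- numerical invariant -/
def GI (L : ℤ) : Ph → Prop
  | .run s => 0 ≤ s.a ∧ s.a < s.x ∧ s.x ≤ s.M ∧ s.x ≤ L ∧ (s.x0 :: s.xs).Pairwise (· ≤ ·) ∧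
      ∀ y ∈ s.x0 :: s.xs, s.a < y ∧ y ≤ L
  | _ => True

lemma GI_start {L a : ℤ} {u : ℤ → ℕ} {xs : List ℤ} (ha : 0 ≤ a) (h1 : xs.Pairwise (· ≤ ·))
    (h2 : ∀ y ∈ xs, a < y ∧ y ≤ L) : GI L (start a u xs) := by
  cases xs with
  | nil => trivial
  | cons x xs =>
    have := h2 x (by simp)
    exact ⟨ha, this.1, le_rfl, this.2, h1, h2⟩

lemma GI_stp {L : ℤ} {s : TS} (h : GI L (.run s)) {v : Option ℤ}
    (hv : v = none ∨ v = some 1 ∨ v = some (-1)) : GI L (stp L s v) := by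
  obtain ⟨h1, h2, h3, h4, h5, h6⟩ := h
  cases v with
  | none => exact ⟨h1, h2, le_rfl, h4, h5, h6⟩
  | some z =>
    have hz : z = 1 ∨ z = -1 := by simpa using hv
    simp only [stp]
    rw [List.pairwise_cons] at h5
    have h6' : ∀ y ∈ s.xs, s.a < y ∧ y ≤ L := fun y hy => h6 y (List.mem_cons_of_mem _ hy)
    split_ifs with e1 e2 e3
    · refine GI_start (by omega) h5.2 fun y hy => ⟨?_, (h6' y hy).2⟩
      have := h5.1 y hy; omega
    · trivial
    · exact GI_start h1 h5.2 h6'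
    · refine ⟨h1, ?_, le_max_right _ _, ?_, List.pairwise_cons.2 h5, h6⟩
      · dsimp only; omega
      · dsimp only; omega

/-! ### Potentials -/

noncomputable def pr (ε : ℝ) : ℝ := 1 - ε
noncomputable def ps (ε : ℝ) : ℝ := 1 - ε / 2
noncomputable def pE (ε : ℝ) : ℝ := ps ε / pr ε

noncomputable def phi (ε : ℝ) (X Y : ℤ) : ℝ :=
  17 - 16 * ps ε ^ X + ps ε ^ Y + pr ε ^ X * pE ε ^ Y

noncomputable def RR (ε : ℝ) (a : ℤ) : List ℤ → ℝ
  | [] => 0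
  | x :: l => pE ε ^ (a - x) + 19 * RR ε a l

section
variable {ε : ℝ} (h0 : 0 < ε) (h1 : ε ≤ 1 / 2)
include h0 h1

lemma pr_pos : 0 < pr ε := by unfold pr; linarith
lemma ps_pos : 0 < ps ε := by unfold ps; linarith
lemma pE_pos : 0 < pE ε := div_pos (ps_pos h0 h1) (pr_pos h0 h1)

lemma pE_ge : 1 + ε / 2 ≤ pE ε := by
  unfold pE
  rw [le_div_iff₀ (pr_pos h0 h1)]
  unfold ps pr
  nlinarith

lemma ps_zpow_le {X : ℤ} (hX : 0 ≤ X) : ps ε ^ X ≤ 1 := by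
  lift X to ℕ using hX
  rw [zpow_natCast]
  exact pow_le_one₀ (ps_pos h0 h1).le (by unfold ps; linarith)

lemma phi_ge_one {X Y : ℤ} (hX : 0 ≤ X) : 1 ≤ phi ε X Y := by
  have := ps_zpow_le h0 h1 hX
  have h2 := zpow_pos (ps_pos h0 h1) Y
  have h3 := mul_pos (zpow_pos (pr_pos h0 h1) X) (zpow_pos (pE_pos h0 h1) Y)
  unfold phi; linarith

lemma phi_zero_ge {Y : ℤ} : pE ε ^ Y ≤ phi ε 0 Y := by
  have h2 := zpow_pos (ps_pos h0 h1) Y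
  unfold phi; simp; linarith

lemma phi_diag_le {X : ℤ} : phi ε X X ≤ 19 := by
  have h2 := zpow_pos (ps_pos h0 h1) X
  have h3 : pr ε ^ X * pE ε ^ X = ps ε ^ X := by
    rw [← mul_zpow]; congr 1; unfold pE
    field_simp [(pr_pos h0 h1).ne']
  unfold phi; rw [h3]; linarith

lemma phi_super {X Y : ℤ} (hXY : X ≤ Y) :
    ε ^ 2 * phi ε X X + 1 / 2 * phi ε (X + 1) (max Y (X + 1)) + 1 / 2 * phi ε (X + -1) Y
      ≤ (1 + ε ^ 2) * phi ε X Y := by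
  have hr := pr_pos h0 h1
  have hs := ps_pos h0 h1
  have hE := pE_pos h0 h1
  have hS := zpow_pos hs X
  have hT := zpow_pos hs Y
  have h3 : pr ε ^ X * pE ε ^ X = ps ε ^ X := by
    rw [← mul_zpow]; congr 1; unfold pE
    field_simp
  have h3' : pr ε ^ (X + 1) * pE ε ^ (X + 1) = ps ε ^ X * ps ε := by
    rw [← mul_zpow, ← zpow_add_one₀ hs.ne']; congr 1; unfold pE
    field_simp
  have e1 : ps ε ^ (X + 1) = ps ε ^ X * ps ε := zpow_add_one₀ hs.ne' X
  have e2 : ps ε ^ (X + -1) = ps ε ^ X / ps ε := by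
    rw [← sub_eq_add_neg, zpow_sub_one₀ hs.ne']; rfl
  have e3 : pr ε ^ (X + 1) = pr ε ^ X * pr ε := zpow_add_one₀ hr.ne' X
  have e4 : pr ε ^ (X + -1) = pr ε ^ X / pr ε := by
    rw [← sub_eq_add_neg, zpow_sub_one₀ hr.ne']; rfl
  have k1 : 2 * ε ^ 2 ≤ 8 * (ps ε + 1 / ps ε - 2) := by
    have : 8 * (ps ε + 1 / ps ε - 2) = 2 * ε ^ 2 / ps ε := by
      field_simp; unfold ps; ring
    rw [this, le_div_iff₀ hs]
    have : ps ε ≤ 1 := by unfold ps; linarith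
    nlinarith [sq_nonneg ε]
  have k2 : (pr ε + 1 / pr ε) / 2 ≤ 1 + ε ^ 2 := by
    have : (pr ε + 1 / pr ε) / 2 = 1 + ε ^ 2 / (2 * pr ε) := by
      field_simp; unfold pr; ring
    rw [this]
    have : ε ^ 2 / (2 * pr ε) ≤ ε ^ 2 := by
      rw [div_le_iff₀ (by linarith)]
      have : 1 ≤ 2 * pr ε := by unfold pr; linarith
      nlinarith [sq_nonneg ε]
    linarith
  rcases hXY.lt_or_eq with hlt | rfl
  · rw [max_eq_left (by omega)]
    simp only [phi, h3, e1, e2, e3, e4]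
    have hB := mul_pos (zpow_pos hr X) (zpow_pos hE Y)
    set S := ps ε ^ X
    set T := ps ε ^ Y
    have eB : pr ε ^ X * pr ε * pE ε ^ Y = (pr ε ^ X * pE ε ^ Y) * pr ε := by ring
    have eB' : pr ε ^ X / pr ε * pE ε ^ Y = (pr ε ^ X * pE ε ^ Y) * (1 / pr ε) := by ring
    rw [eB, eB']
    set B := pr ε ^ X * pE ε ^ Y
    have m1 := mul_le_mul_of_nonneg_left k1 hS.le
    have m2 := mul_le_mul_of_nonneg_left k2 hB.le
    have m3 : 0 ≤ ε ^ 2 * T := by positivity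
    have eS : S / ps ε = S * (1 / ps ε) := by ring
    rw [eS]
    nlinarith
  · rw [max_eq_right (by omega)]
    have e5 : pr ε ^ (X + -1) * pE ε ^ X = ps ε ^ X * (1 / pr ε) := by
      rw [e4, ← h3]; ring
    simp only [phi, h3, h3', e1, e2, e5]
    set S := ps ε ^ X
    have k3 : ps ε + 1 / 2 + (1 / pr ε) / 2 - 2 ≤ 8 * (ps ε + 1 / ps ε - 2) := by
      refine le_trans ?_ k1
      have : ps ε + 1 / 2 + (1 / pr ε) / 2 - 2 = ε ^ 2 / (2 * pr ε) := by
        field_simp; unfold ps pr; ring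
      rw [this, div_le_iff₀ (by linarith)]
      have : 1 ≤ 2 * pr ε := by unfold pr; linarith
      nlinarith [sq_nonneg ε]
    have m1 := mul_le_mul_of_nonneg_left k3 hS.le
    have eS : S / ps ε = S * (1 / ps ε) := by ring
    rw [eS]
    nlinarith

lemma RR_nonneg (a : ℤ) (l : List ℤ) : 0 ≤ RR ε a l := by
  induction l with
  | nil => exact le_rfl
  | cons x l ih =>
    have := zpow_pos (pE_pos h0 h1) (a - x)
    simp only [RR]; linarith

lemma RR_shift (a k : ℤ) (l : List ℤ) : RR ε (a + k) l = pE ε ^ k * RR ε a l := by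
  induction l with
  | nil => simp [RR]
  | cons x l ih =>
    simp only [RR, ih]
    rw [show a + k - x = k + (a - x) by ring, zpow_add₀ (pE_pos h0 h1).ne']
    ring

end

noncomputable def Fp (ε : ℝ) : Ph → ℝ
  | .run s => phi ε (s.x - s.a) (s.M - s.a) * RR ε s.a (s.x0 :: s.xs)
  | .done _ => 0
  | .fail => 1

noncomputable def Gp (L : ℤ) : Ph → ℝ
  | .run s => 2 ^ s.xs.length * (2 * ((L : ℝ) + 1) ^ 2 - (s.x : ℝ) ^ 2)
  | .done _ => 0
  | .fail => 0

section
variable {ε : ℝ} (h0 : 0 < ε) (h1 : ε ≤ 1 / 2)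
include h0 h1

lemma Fp_start (a : ℤ) (u : ℤ → ℕ) (xs : List ℤ) : Fp ε (start a u xs) ≤ 19 * RR ε a xs := by
  cases xs with
  | nil => simp [start, Fp, RR]
  | cons x xs =>
    simp only [start, Fp]
    exact mul_le_mul_of_nonneg_right (phi_diag_le h0 h1) (RR_nonneg h0 h1 _ _)

lemma Fp_nonneg {L : ℤ} {φ : Ph} (h : GI L φ) : 0 ≤ Fp ε φ := by
  cases φ with
  | done => exact le_rfl
  | fail => exact zero_le_one
  | run s =>
    obtain ⟨h2, h3, h4, _⟩ := h
    exact mul_nonneg (zero_le_one.trans (phi_ge_one h0 h1 (by omega))) (RR_nonneg h0 h1 _ _)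

lemma Fp_stp {L : ℤ} {s : TS} (h : GI L (.run s)) {z : ℤ} (hz : z = 1 ∨ z = -1) :
    Fp ε (stp L s (some z)) ≤
      phi ε (s.x - s.a + z) (max (s.M - s.a) (s.x - s.a + z)) * RR ε s.a (s.x0 :: s.xs) := by
  obtain ⟨h2, h3, h4, h5, h6, h7⟩ := h
  have hR := RR_nonneg h0 h1 s.a s.xs
  have hRR := RR_nonneg h0 h1 s.a (s.x0 :: s.xs)
  have hE := pE_pos h0 h1
  have hE0 := zpow_pos hE (s.a - s.x0)
  simp only [stp]
  split_ifs with e1 e2 e3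
  · rw [show s.x - s.a + z = 0 by omega, max_eq_left (by omega)]
    refine (Fp_start h0 h1 _ _ _).trans ?_
    have := RR_shift h0 h1 s.a (s.M - s.a) s.xs
    rw [add_sub_cancel] at this
    rw [this]
    have h8 := phi_zero_ge h0 h1 (Y := s.M - s.a)
    have hEY := zpow_pos hE (s.M - s.a)
    calc 19 * (pE ε ^ (s.M - s.a) * RR ε s.a s.xs)
        = pE ε ^ (s.M - s.a) * (19 * RR ε s.a s.xs) := by ring
      _ ≤ pE ε ^ (s.M - s.a) * RR ε s.a (s.x0 :: s.xs) := by
          refine mul_le_mul_of_nonneg_left ?_ hEY.le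
          simp only [RR]; linarith
      _ ≤ _ := mul_le_mul_of_nonneg_right h8 hRR
  · rw [show s.x - s.a + z = 0 by omega, max_eq_left (by omega)]
    have h8 := phi_zero_ge h0 h1 (Y := s.M - s.a)
    have hEY := zpow_pos hE (s.M - s.a)
    simp only [Fp]
    calc (1 : ℝ) = pE ε ^ (0 : ℤ) := by simp
      _ ≤ pE ε ^ (s.M - s.a + (s.a - s.x0)) := by
          refine zpow_le_zpow_right₀ ?_ (by omega)
          have := pE_ge h0 h1; linarith
      _ = pE ε ^ (s.M - s.a) * pE ε ^ (s.a - s.x0) := zpow_add₀ hE.ne' _ _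
      _ ≤ pE ε ^ (s.M - s.a) * RR ε s.a (s.x0 :: s.xs) := by
          refine mul_le_mul_of_nonneg_left ?_ hEY.le
          simp only [RR]; linarith
      _ ≤ _ := mul_le_mul_of_nonneg_right h8 hRR
  · refine (Fp_start h0 h1 _ _ _).trans ?_
    have h8 := phi_ge_one h0 h1 (X := s.x - s.a + z)
      (Y := max (s.M - s.a) (s.x - s.a + z)) (by omega)
    calc 19 * RR ε s.a s.xs ≤ 1 * RR ε s.a (s.x0 :: s.xs) := by simp only [RR]; linarith
      _ ≤ _ := mul_le_mul_of_nonneg_right h8 hRR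
  · simp only [Fp]
    rw [show s.x + z - s.a = s.x - s.a + z by ring,
      show max s.M (s.x + z) - s.a = max (s.M - s.a) (s.x - s.a + z) by omega]

lemma Fp_super {L : ℤ} {s : TS} (h : GI L (.run s)) :
    ε ^ 2 * Fp ε (stp L s none) + 1 / 2 * Fp ε (stp L s (some 1))
      + 1 / 2 * Fp ε (stp L s (some (-1))) ≤ (1 + ε ^ 2) * Fp ε (.run s) := by
  have a1 := Fp_stp h0 h1 h (z := 1) (by simp)
  have a2 := Fp_stp h0 h1 h (z := -1) (by simp)
  obtain ⟨h2, h3, h4, h5, h6, h7⟩ := h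
  have hRR := RR_nonneg h0 h1 s.a (s.x0 :: s.xs)
  rw [max_eq_left (show s.x - s.a + -1 ≤ s.M - s.a by omega)] at a2
  have a3 := mul_le_mul_of_nonneg_right
    (phi_super h0 h1 (X := s.x - s.a) (Y := s.M - s.a) (by omega)) hRR
  have a4 : Fp ε (stp L s none) = phi ε (s.x - s.a) (s.x - s.a) * RR ε s.a (s.x0 :: s.xs) := rfl
  have a5 : Fp ε (.run s) = phi ε (s.x - s.a) (s.M - s.a) * RR ε s.a (s.x0 :: s.xs) := rfl
  rw [a4, a5]
  nlinarith

end

lemma Gp_nonneg {L : ℤ} {φ : Ph} (h : GI L φ) : 0 ≤ Gp L φ := by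
  cases φ with
  | done => exact le_rfl
  | fail => exact le_rfl
  | run s =>
    obtain ⟨h2, h3, h4, h5, _⟩ := h
    have : (s.x : ℝ) ≤ L := by exact_mod_cast h5
    have : (0 : ℝ) ≤ s.x := by exact_mod_cast (by omega : 0 ≤ s.x)
    refine mul_nonneg (by positivity) ?_
    nlinarith

lemma Gp_ge_one {L : ℤ} {s : TS} (h : GI L (.run s)) : 1 ≤ Gp L (.run s) := by
  obtain ⟨h2, h3, h4, h5, _⟩ := h
  have : (s.x : ℝ) ≤ L := by exact_mod_cast h5
  have : (0 : ℝ) ≤ s.x := by exact_mod_cast (by omega : 0 ≤ s.x)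
  have k : 1 ≤ (2 * ((L : ℝ) + 1) ^ 2 - (s.x : ℝ) ^ 2) := by nlinarith
  have k2 : (1 : ℝ) ≤ 2 ^ s.xs.length := one_le_pow₀ (by norm_num)
  simp only [Gp]
  nlinarith

lemma Gp_start (L a : ℤ) (u : ℤ → ℕ) (xs : List ℤ) :
    Gp L (start a u xs) ≤ 2 ^ xs.length * ((L : ℝ) + 1) ^ 2 := by
  cases xs with
  | nil => simp only [start, Gp]; positivity
  | cons x xs =>
    simp only [start, Gp, List.length_cons, pow_succ]
    have : (0 : ℝ) ≤ 2 ^ xs.length := by positivity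
    nlinarith [mul_nonneg this (sq_nonneg (x : ℝ))]

lemma Gp_stp {L : ℤ} {s : TS} (h : GI L (.run s)) {z : ℤ} (hz : z = 1 ∨ z = -1) :
    Gp L (stp L s (some z)) ≤
      2 ^ s.xs.length * (2 * ((L : ℝ) + 1) ^ 2 - ((s.x : ℝ) + z) ^ 2) := by
  obtain ⟨h2, h3, h4, h5, h6, h7⟩ := h
  have i1 : ((s.x : ℝ) + z) ≤ L + 1 := by exact_mod_cast (by omega : s.x + z ≤ L + 1)
  have i2 : 0 ≤ ((s.x : ℝ) + z) := by exact_mod_cast (by omega : 0 ≤ s.x + z)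
  have i3 : ((L : ℝ) + 1) ^ 2 ≤ (2 * ((L : ℝ) + 1) ^ 2 - ((s.x : ℝ) + z) ^ 2) := by nlinarith
  have i4 : (0 : ℝ) ≤ 2 ^ s.xs.length := by positivity
  have i5 := mul_le_mul_of_nonneg_left i3 i4
  simp only [stp]
  split_ifs with e1 e2 e3
  · exact (Gp_start _ _ _ _).trans i5
  · exact le_trans (by simp only [Gp]; positivity) i5
  · exact (Gp_start _ _ _ _).trans i5
  · simp only [Gp]; push_cast; exact le_rfl

/-- decay rate -/
noncomputable def kap (ε : ℝ) (L : ℤ) : ℝ := 1 - 1 / (2 * (1 + ε ^ 2) * ((L : ℝ) + 1) ^ 2)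

lemma Gp_super (ε : ℝ) {L : ℤ} {s : TS} (h : GI L (.run s)) :
    ε ^ 2 * Gp L (stp L s none) + 1 / 2 * Gp L (stp L s (some 1))
      + 1 / 2 * Gp L (stp L s (some (-1))) ≤ (1 + ε ^ 2) * (kap ε L * Gp L (.run s)) := by
  have a1 := Gp_stp h (z := 1) (by simp)
  have a2 := Gp_stp h (z := -1) (by simp)
  obtain ⟨h2, h3, h4, h5, h6, h7⟩ := h
  have a4 : Gp L (stp L s none)
    = 2 ^ s.xs.length * (2 * ((L : ℝ) + 1) ^ 2 - (s.x : ℝ) ^ 2) := rfl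
  have a5 : Gp L (.run s)
    = 2 ^ s.xs.length * (2 * ((L : ℝ) + 1) ^ 2 - (s.x : ℝ) ^ 2) := rfl
  rw [a4, a5]
  have hL : (0 : ℝ) ≤ L := by exact_mod_cast (by omega : 0 ≤ L)
  have i4 : (0 : ℝ) ≤ 2 ^ s.xs.length := by positivity
  set N : ℝ := 2 ^ s.xs.length
  have hk : (1 + ε ^ 2) * kap ε L = (1 + ε ^ 2) - 1 / (2 * ((L : ℝ) + 1) ^ 2) := by
    unfold kap; field_simp
  rw [← mul_assoc (1 + ε ^ 2) (kap ε L), hk]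
  have hb : 1 / (2 * ((L : ℝ) + 1) ^ 2) * (N * (2 * ((L : ℝ) + 1) ^ 2 - (s.x : ℝ) ^ 2)) ≤ N := by
    rw [one_div, inv_mul_le_iff₀ (by positivity)]
    nlinarith [mul_nonneg i4 (sq_nonneg (s.x : ℝ))]
  push_cast at a1 a2
  nlinarith

lemma kap_mem (ε : ℝ) {L : ℤ} (hL : 0 ≤ L) : 0 ≤ kap ε L ∧ kap ε L < 1 := by
  have hL : (0 : ℝ) ≤ L := by exact_mod_cast hL
  unfold kap
  constructor
  · rw [sub_nonneg, div_le_one (by positivity)]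
    nlinarith [sq_nonneg ε, mul_nonneg (sq_nonneg ε) hL]
  · have : 0 < 1 / (2 * (1 + ε ^ 2) * ((L : ℝ) + 1) ^ 2) := by positivity
    linarith

end ARWp
namespace ARWp

/-! ### Probability bound for the exploration -/

/-- instruction weights -/
noncomputable def Wt (ε : ℝ) : Option ℤ → ℝ
  | none => ε ^ 2 / (1 + ε ^ 2)
  | some z => if z = 1 ∨ z = -1 then 1 / 2 / (1 + ε ^ 2) else 0

lemma Wt_nonneg (ε : ℝ) (v : Option ℤ) : 0 ≤ Wt ε v := by
  cases v with
  | none => simp only [Wt]; positivity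
  | some z => simp only [Wt]; split_ifs <;> positivity

noncomputable def Pot (ε : ℝ) (L : ℤ) (n : ℕ) (φ : Ph) : ℝ := Fp ε φ + kap ε L ^ n * Gp L φ

section
variable {ε : ℝ} (h0 : 0 < ε) (h1 : ε ≤ 1 / 2)
include h0 h1

lemma Pot_nonneg {L : ℤ} (hL : 0 ≤ L) {φ : Ph} (n : ℕ) (h : GI L φ) : 0 ≤ Pot ε L n φ :=
  add_nonneg (Fp_nonneg h0 h1 h) (mul_nonneg (pow_nonneg (kap_mem ε hL).1 _) (Gp_nonneg h))

lemma Pot_super {L : ℤ} (hL : 0 ≤ L) {s : TS} (n : ℕ) (h : GI L (.run s)) :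
    Wt ε none * Pot ε L n (stp L s none) + Wt ε (some 1) * Pot ε L n (stp L s (some 1))
      + Wt ε (some (-1)) * Pot ε L n (stp L s (some (-1))) ≤ Pot ε L (n + 1) (.run s) := by
  have a1 := Fp_super h0 h1 h
  have a2 := mul_le_mul_of_nonneg_left (Gp_super ε h) (pow_nonneg (kap_mem ε hL).1 n)
  have hp : 0 < 1 + ε ^ 2 := by positivity
  simp only [Wt, Pot, true_or, or_true, if_true]
  rw [← sub_nonneg]
  have : ∀ A B C A' B' C' D D' : ℝ, D + kap ε L ^ (n + 1) * D' -
      (ε ^ 2 / (1 + ε ^ 2) * (A + kap ε L ^ n * A') + 1 / 2 / (1 + ε ^ 2) * (B + kap ε L ^ n * B')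
        + 1 / 2 / (1 + ε ^ 2) * (C + kap ε L ^ n * C')) =
      ((1 + ε ^ 2) * D - (ε ^ 2 * A + 1 / 2 * B + 1 / 2 * C) +
      (kap ε L ^ n * ((1 + ε ^ 2) * (kap ε L * D')) -
        kap ε L ^ n * (ε ^ 2 * A' + 1 / 2 * B' + 1 / 2 * C'))) / (1 + ε ^ 2) := by
    intros; field_simp; ring
  rw [this]
  exact div_nonneg (by linarith) hp.le

end

/-- the instructions in `Γ` have already been used -/
def Fresh (Γ : Finset (ℤ × ℕ)) : Ph → Prop
  | .run s => (∀ i ∈ Γ, i.1 ≤ s.a ∨ i.2 < s.r i.1) ∧ ∀ y, s.M < y → s.u y = s.r y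
  | _ => True

lemma Fresh_start {Γ : Finset (ℤ × ℕ)} {a : ℤ} {u : ℤ → ℕ} {xs : List ℤ}
    (h : ∀ i ∈ Γ, i.1 ≤ a ∨ i.2 < u i.1) : Fresh Γ (start a u xs) := by
  cases xs with
  | nil => trivial
  | cons x xs => exact ⟨h, fun _ _ => rfl⟩

lemma r'_ge (s : TS) (y : ℤ) : s.r y ≤ s.r' y := by
  unfold TS.r'
  by_cases h : y = s.x
  · subst h; simp
  · simp [h]

lemma r'_self (s : TS) : s.r' s.x = s.r s.x + 1 := by simp [TS.r']

lemma r'_ne (s : TS) {y : ℤ} (h : y ≠ s.x) : s.r' y = s.r y := by simp [TS.r', h]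

lemma Fresh_stp {L : ℤ} {Γ : Finset (ℤ × ℕ)} {s : TS} (hG : GI L (.run s)) (h : Fresh Γ (.run s))
    (v : Option ℤ) : Fresh (insert (s.x, s.r s.x) Γ) (stp L s v) := by
  obtain ⟨f1, f2⟩ := h
  obtain ⟨h2, h3, h4, h5, h6, h7⟩ := hG
  have k1 : ∀ i ∈ insert (s.x, s.r s.x) Γ, i.1 ≤ s.a ∨ i.2 < s.r' i.1 := by
    intro i hi
    rcases Finset.mem_insert.1 hi with rfl | hi
    · right; dsimp only; rw [r'_self]; omega
    · rcases f1 i hi with h | h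
      · exact Or.inl h
      · exact Or.inr (h.trans_le (r'_ge s _))
  cases v with
  | none => exact ⟨k1, fun _ _ => rfl⟩
  | some z =>
    simp only [stp]
    split_ifs with e1 e2 e3
    · refine Fresh_start fun i hi => ?_
      rcases Finset.mem_insert.1 hi with rfl | hi
      · left; exact h4
      · rcases f1 i hi with h | h
        · left; omega
        · by_cases hM : i.1 ≤ s.M
          · exact Or.inl hM
          · right; rw [f2 _ (by omega)]; exact h
    · trivial
    · exact Fresh_start k1
    · refine ⟨k1, fun y hy => ?_⟩
      dsimp only at hy ⊢
      have : s.M < y := (le_max_left _ _).trans_lt hy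
      rw [r'_ne s (by omega), f2 y this]

lemma prob_bound {ε : ℝ} (h0 : 0 < ε) (h1 : ε ≤ 1 / 2) {Ω : Type*} [MeasurableSpace Ω]
    (μ : Measure Ω) (J : Ω → ℤ → ℕ → Option ℤ)
    (hcyl : ∀ (Γ : Finset (ℤ × ℕ)) (g : ℤ × ℕ → Option ℤ),
      μ {ω | ∀ i ∈ Γ, J ω i.1 i.2 = g i} ≤ ENNReal.ofReal (∏ i ∈ Γ, Wt ε (g i)))
    (hNN : ∀ᵐ ω ∂μ, NN (J ω)) {L : ℤ} (hL : 0 ≤ L) (n : ℕ) :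
    ∀ (φ : Ph) (Γ : Finset (ℤ × ℕ)) (g : ℤ × ℕ → Option ℤ), GI L φ → Fresh Γ φ →
      μ ({ω | ∀ i ∈ Γ, J ω i.1 i.2 = g i} ∩ {ω | ¬ isDone (runN L (J ω) n φ)}) ≤
        ENNReal.ofReal ((∏ i ∈ Γ, Wt ε (g i)) * Pot ε L n φ) := by
  have base : ∀ (n : ℕ) (φ : Ph) (Γ : Finset (ℤ × ℕ)) (g : ℤ × ℕ → Option ℤ),
      1 ≤ Pot ε L n φ → ∀ S : Set Ω, 
      μ ({ω | ∀ i ∈ Γ, J ω i.1 i.2 = g i} ∩ S) ≤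
        ENNReal.ofReal ((∏ i ∈ Γ, Wt ε (g i)) * Pot ε L n φ) := by
    intro n φ Γ g hP S
    refine (measure_mono Set.inter_subset_left).trans ((hcyl Γ g).trans ?_)
    refine ENNReal.ofReal_le_ofReal ?_
    exact le_mul_of_one_le_right (Finset.prod_nonneg fun _ _ => Wt_nonneg ε _) hP
  have hdone : ∀ (n : ℕ) (u : ℤ → ℕ) (Γ : Finset (ℤ × ℕ)) (g : ℤ × ℕ → Option ℤ),
      μ ({ω | ∀ i ∈ Γ, J ω i.1 i.2 = g i} ∩ {ω | ¬ isDone (runN L (J ω) n (.done u))}) ≤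
        ENNReal.ofReal ((∏ i ∈ Γ, Wt ε (g i)) * Pot ε L n (.done u)) := by
    intro n u Γ g
    have : {ω | ¬ isDone (runN L (J ω) n (.done u))} = ∅ := by
      ext ω
      cases n <;> simp [runN, isDone]
    rw [this]; simp
  induction n with
  | zero =>
    intro φ Γ g hG hF
    cases φ with
    | done u => exact hdone _ _ _ _
    | fail => exact base _ _ _ _ (by simp [Pot, Fp, Gp]) _
    | run s =>
      refine base _ _ _ _ ?_ _
      have := Fp_nonneg h0 h1 hG
      have := Gp_ge_one hG
      simp only [Pot, pow_zero, one_mul]; linarith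
  | succ n ih =>
    intro φ Γ g hG hF
    cases φ with
    | done u => exact hdone _ _ _ _
    | fail => exact base _ _ _ _ (by simp [Pot, Fp, Gp]) _
    | run s =>
      set i0 : ℤ × ℕ := (s.x, s.r s.x) with hi0
      have hi0Γ : i0 ∉ Γ := by
        intro hi
        rcases hF.1 i0 hi with h | h
        · have := hG.2.1; simp only [hi0] at h; omega
        · simp only [hi0] at h; omega
      set A : Option ℤ → Set Ω := fun v =>
        {ω | ∀ i ∈ insert i0 Γ, J ω i.1 i.2 = Function.update g i0 v i} ∩
          {ω | ¬ isDone (runN L (J ω) n (stp L s v))} with hA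
      have hAv : ∀ v, (v = none ∨ v = some 1 ∨ v = some (-1)) → μ (A v) ≤
          ENNReal.ofReal ((∏ i ∈ Γ, Wt ε (g i)) * (Wt ε v * Pot ε L n (stp L s v))) := by
        intro v hv
        refine (ih (stp L s v) (insert i0 Γ) (Function.update g i0 v) (GI_stp hG hv)
          (Fresh_stp hG hF v)).trans (le_of_eq ?_)
        congr 1
        rw [Finset.prod_insert hi0Γ, Function.update_self]
        have : ∏ i ∈ Γ, Wt ε (Function.update g i0 v i) = ∏ i ∈ Γ, Wt ε (g i) := by
          refine Finset.prod_congr rfl fun i hi => ?_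
          rw [Function.update_of_ne]
          rintro rfl
          exact hi0Γ hi
        rw [this]
        ring
      have hsub : ({ω | ∀ i ∈ Γ, J ω i.1 i.2 = g i} ∩
          {ω | ¬ isDone (runN L (J ω) (n + 1) (.run s))} : Set Ω) ≤ᵐ[μ]
          (A none ∪ A (some 1) ∪ A (some (-1)) : Set Ω) := by
        filter_upwards [hNN] with ω hω hmem
        obtain ⟨m1, m2⟩ := hmem
        have hmemA : ω ∈ A (J ω s.x (s.r s.x)) := by
          refine ⟨?_, m2⟩
          intro i hi
          by_cases hii : i = i0
          · subst hii; simp [hi0]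
          · rw [Function.update_of_ne hii]
            exact m1 i ((Finset.mem_insert.1 hi).resolve_left hii)
        change ω ∈ (A none ∪ A (some 1) ∪ A (some (-1)) : Set Ω)
        rcases hω s.x (s.r s.x) with h | h | h <;> rw [h] at hmemA
        · exact Or.inl (Or.inl hmemA)
        · exact Or.inl (Or.inr hmemA)
        · exact Or.inr hmemA
      have hP : 0 ≤ ∏ i ∈ Γ, Wt ε (g i) := Finset.prod_nonneg fun _ _ => Wt_nonneg ε _
      have hnn : ∀ v, (v = none ∨ v = some 1 ∨ v = some (-1)) →
          0 ≤ (∏ i ∈ Γ, Wt ε (g i)) * (Wt ε v * Pot ε L n (stp L s v)) := fun v hv =>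
        mul_nonneg hP (mul_nonneg (Wt_nonneg ε v) (Pot_nonneg h0 h1 hL n (GI_stp hG hv)))
      calc μ _ ≤ μ (A none ∪ A (some 1) ∪ A (some (-1))) := measure_mono_ae hsub
        _ ≤ μ (A none) + μ (A (some 1)) + μ (A (some (-1))) :=
          (measure_union_le _ _).trans (add_le_add_left (measure_union_le _ _) _)
        _ ≤ ENNReal.ofReal _ + ENNReal.ofReal _ + ENNReal.ofReal _ :=
          add_le_add (add_le_add (hAv _ (by simp)) (hAv _ (by simp))) (hAv _ (by simp))
        _ = ENNReal.ofReal ((∏ i ∈ Γ, Wt ε (g i)) * (Wt ε none * Pot ε L n (stp L s none) +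
            Wt ε (some 1) * Pot ε L n (stp L s (some 1))
            + Wt ε (some (-1)) * Pot ε L n (stp L s (some (-1))))) := by
          rw [← ENNReal.ofReal_add (hnn _ (by simp)) (hnn _ (by simp)),
            ← ENNReal.ofReal_add (add_nonneg (hnn _ (by simp)) (hnn _ (by simp)))
              (hnn _ (by simp))]
          congr 1; ring
        _ ≤ _ := ENNReal.ofReal_le_ofReal
          (mul_le_mul_of_nonneg_left (Pot_super h0 h1 hL n hG) hP)

/-- probability that the exploration does not succeed -/
lemma prob_fail {ε : ℝ} (h0 : 0 < ε) (h1 : ε ≤ 1 / 2) {Ω : Type*} [MeasurableSpace Ω]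
    (μ : Measure Ω) (J : Ω → ℤ → ℕ → Option ℤ)
    (hcyl : ∀ (Γ : Finset (ℤ × ℕ)) (g : ℤ × ℕ → Option ℤ),
      μ {ω | ∀ i ∈ Γ, J ω i.1 i.2 = g i} ≤ ENNReal.ofReal (∏ i ∈ Γ, Wt ε (g i)))
    (hNN : ∀ᵐ ω ∂μ, NN (J ω)) {L : ℤ} (hL : 0 ≤ L) (xs : List ℤ)
    (hs : xs.Pairwise (· ≤ ·)) (hx : ∀ y ∈ xs, 0 < y ∧ y ≤ L) :
    μ {ω | ∀ n, ¬ isDone (runN L (J ω) n (start 0 (fun _ => 0) xs))} ≤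
      ENNReal.ofReal (19 * RR ε 0 xs) := by
  set φ := start 0 (fun _ => 0) xs
  have hG : GI L φ := GI_start le_rfl hs hx
  have hF : Fresh ∅ φ := Fresh_start (by simp)
  have hb : ∀ n, μ {ω | ∀ n, ¬ isDone (runN L (J ω) n φ)} ≤ ENNReal.ofReal (Pot ε L n φ) := by
    intro n
    have := prob_bound h0 h1 μ J hcyl hNN hL n φ ∅ (fun _ => none) hG hF
    simp only [Finset.prod_empty, one_mul] at this
    refine le_trans (measure_mono ?_) this
    intro ω hω
    exact ⟨by simp, hω n⟩
  have hk := kap_mem ε hL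
  have hlim : Tendsto (fun n => ENNReal.ofReal (Pot ε L n φ)) atTop
      (𝓝 (ENNReal.ofReal (Fp ε φ + 0 * Gp L φ))) := by
    refine ENNReal.tendsto_ofReal ?_
    exact tendsto_const_nhds.add ((tendsto_pow_atTop_nhds_zero_of_lt_one hk.1 hk.2).mul_const _)
  refine (ge_of_tendsto' hlim hb).trans ?_
  rw [zero_mul, add_zero]
  exact ENNReal.ofReal_le_ofReal (Fp_start h0 h1 _ _ _)

/-! ### Deterministic invariant of the exploration -/

section det
variable (J : ℤ → ℕ → Option ℤ) (η : ℤ → ℕ) (L : ℤ)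

def OKs (u : ℤ → ℕ) (y : ℤ) : Prop :=
  Hh J η u y ≤ 0 ∨ (Hh J η u y = 1 ∧ ∃ k, u y = k + 1 ∧ J y k = none)

/-- odometer supported in `[1, L]` and sending nothing to `0` -/
def Supp (u : ℤ → ℕ) : Prop := (∀ y, y ≤ 0 ∨ L < y → u y = 0) ∧ cL J 1 (u 1) = 0

def Settled (a : ℤ) (u : ℤ → ℕ) (xs : List ℤ) : Prop :=
  (∀ y, 1 ≤ y → y ≤ a → OKs J η u y) ∧ (∀ y, a < y → y ≤ L → Hh J η u y = xs.count y) ∧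
    Supp J L u

def DI : Ph → Prop
  | .run s => (∀ y, 1 ≤ y → y ≤ s.a → OKs J η s.r y) ∧
      (∀ y, s.a < y → y ≤ L → Hh J η s.r y = s.xs.count y + if y = s.x then 1 else 0) ∧
      Supp J L s.r ∧ (s.M < s.x0 → Settled J η L s.M s.u s.xs)
  | .done u => (∀ y, 1 ≤ y → y ≤ L → OKs J η u y) ∧ Supp J L u
  | .fail => True

variable {J η L}

lemma Settled.mono {a b : ℤ} {u : ℤ → ℕ} {xs : List ℤ} (h : Settled J η L a u xs) (hab : a ≤ b)
    (hb : b ≤ L) (hx : ∀ y ∈ xs, b < y) : Settled J η L b u xs := by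
  obtain ⟨h1, h2, h3⟩ := h
  refine ⟨fun y hy hyb => ?_, fun y hy => h2 y (by omega), h3⟩
  by_cases hya : y ≤ a
  · exact h1 y hy hya
  · left
    rw [h2 y (by omega) (by omega), List.count_eq_zero_of_not_mem]
    · simp
    · intro hm; have := hx y hm; omega

lemma DI_start {a : ℤ} {u : ℤ → ℕ} {xs : List ℤ} (h : Settled J η L a u xs) :
    DI J η L (start a u xs) := by
  obtain ⟨h1, h2, h3⟩ := h
  cases xs with
  | nil =>
    refine ⟨fun y hy hyL => ?_, h3⟩
    by_cases hya : y ≤ a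
    · exact h1 y hy hya
    · left; rw [h2 y (by omega) hyL]; simp
  | cons x xs =>
    refine ⟨h1, fun y hy hyL => ?_, h3, fun hM => absurd hM (lt_irrefl _)⟩
    dsimp only at hy ⊢
    rw [h2 y hy hyL, List.count_cons]
    by_cases hyx : y = x
    · subst hyx; simp
    · simp [hyx, Ne.symm hyx]

lemma DI_stp (hN : NN J) {s : TS} (hG : GI L (.run s)) (h : DI J η L (.run s)) :
    DI J η L (stp L s (J s.x (s.r s.x))) := by
  obtain ⟨d1, d2, d3, d4⟩ := h
  obtain ⟨g1, g2, g3, g4, g5, g6⟩ := hG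
  rw [List.pairwise_cons] at g5
  have hx0 := g6 s.x0 (by simp)
  have supp' : (J s.x (s.r s.x) = some (-1) → s.x ≠ 1) → Supp J L s.r' := by
    intro hl
    refine ⟨fun y hy => ?_, ?_⟩
    · rw [r'_ne s (by omega)]; exact d3.1 y hy
    · by_cases hx : s.x = 1
      · have : s.r' 1 = s.r 1 + 1 := by rw [← hx]; exact r'_self s
        rw [this, cL_succ, d3.2]
        have : J 1 (s.r 1) ≠ some (-1) := by
          intro h; rw [hx] at hl; exact hl h rfl
        simp [this]
      · rw [r'_ne s (Ne.symm hx)]; exact d3.2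
  cases hJ : J s.x (s.r s.x) with
  | none =>
    have hH : ∀ y, Hh J η s.r' y = Hh J η s.r y := Hh_none hJ
    have supp := supp' (by simp [hJ])
    have ok : ∀ y, 1 ≤ y → y ≤ s.a → OKs J η s.r' y := by
      intro y hy hya
      unfold OKs
      rw [hH, r'_ne s (by omega)]
      exact d1 y hy hya
    refine ⟨ok, fun y hy hyL => ?_, supp, fun hM => ⟨fun y hy hyx => ?_, fun y hy hyL => ?_, supp⟩⟩
    · dsimp only at hy ⊢; rw [hH]; exact d2 y hy hyL
    · dsimp only at hM hyx ⊢
      by_cases hya : y ≤ s.a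
      · exact ok y hy hya
      · have h2 := d2 y (by omega) (by omega)
        have hc : s.xs.count y = 0 := List.count_eq_zero_of_not_mem fun hm => by
          have := g5.1 y hm; omega
        rw [hc] at h2
        unfold OKs
        rw [hH]
        by_cases hyx' : y = s.x
        · right
          refine ⟨by rw [h2]; simp [hyx'], s.r s.x, ?_, ?_⟩
          · rw [hyx']; exact r'_self s
          · rw [hyx']; exact hJ
        · left; rw [h2]; simp [hyx']
    · dsimp only at hy ⊢
      rw [hH, d2 y (by omega) hyL]
      simp [show y ≠ s.x by omega]
  | some z =>
    have hz : z = 1 ∨ z = -1 := by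
      rcases hN s.x (s.r s.x) with h | h | h <;> rw [hJ] at h <;> simp at h <;> simp [h]
    have hH : ∀ y, Hh J η s.r' y =
      Hh J η s.r y - (if y = s.x then 1 else 0) + (if y = s.x + z then 1 else 0) := Hh_jump hN hJ
    simp only [stp]
    split_ifs with e1 e2 e3
    · exact DI_start (d4 e2)
    · trivial
    all_goals
      have supp := supp' (by rw [hJ]; intro h hx; simp at h; omega)
      have ok : ∀ y, 1 ≤ y → y ≤ s.a → OKs J η s.r' y := by
        intro y hy hya
        unfold OKs
        rw [hH, r'_ne s (by omega)]
        simp only [show y ≠ s.x by omega, show y ≠ s.x + z by omega, if_false, sub_zero, add_zero]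
        exact d1 y hy hya
    · refine DI_start ⟨ok, fun y hy hyL => ?_, supp⟩
      rw [hH, d2 y hy hyL]
      simp only [show y ≠ s.x + z by omega, if_false]
      ring
    · refine ⟨ok, fun y hy hyL => ?_, supp, fun hM => ?_⟩
      · dsimp only at hy ⊢
        rw [hH, d2 y hy hyL]
        ring
      · dsimp only at hM ⊢
        have hM' := max_lt_iff.1 hM
        refine (d4 hM'.1).mono (le_max_left _ _) (by omega) fun y hy => ?_
        have := g5.1 y hy
        omega

lemma DI_runN (hN : NN J) (n : ℕ) : ∀ φ, GI L φ → DI J η L φ → DI J η L (runN L J n φ) := by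
  induction n with
  | zero => intro φ _ h; exact h
  | succ n ih =>
    intro φ hG h
    cases φ with
    | done u => exact h
    | fail => exact h
    | run s => exact ih _ (GI_stp hG (hN _ _)) (DI_stp hN hG h)

lemma done_spec (hN : NN J) {xs : List ℤ} (hs : xs.Pairwise (· ≤ ·))
    (hx : ∀ y ∈ xs, 0 < y ∧ y ≤ L) (hc : ∀ y, 0 < y → y ≤ L → xs.count y = η y) {n : ℕ}
    (h : isDone (runN L J n (start 0 (fun _ => 0) xs))) :
    ∃ u, (∀ y, 1 ≤ y → y ≤ L → OKs J η u y) ∧ Supp J L u := by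
  have hd := DI_runN (η := η) hN n _ (GI_start (u := fun _ => 0) le_rfl hs hx) (DI_start (xs := xs)
    ⟨fun y _ _ => by omega, fun y hy hyL => by
      rw [hc y hy hyL]; simp [Hh, cR_zero, cL_zero], fun _ _ => rfl, rfl⟩)
  revert hd h
  cases runN L J n (start 0 (fun _ => 0) xs) with
  | done u => intro _ h; exact ⟨u, h⟩
  | fail => intro h; exact h.elim
  | run s => intro h; exact h.elim

end det

end ARWp
namespace ARWp

/-! ### The list of particle positions -/

/-- positions of the particles in `(y, y + n]` -/
def bl (η : ℤ → ℕ) : ℤ → ℕ → List ℤ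
  | _, 0 => []
  | y, n + 1 => List.replicate (η (y + 1)) (y + 1) ++ bl η (y + 1) n

lemma bl_mem {η : ℤ → ℕ} {n : ℕ} : ∀ {y : ℤ}, ∀ x ∈ bl η y n, y < x ∧ x ≤ y + n := by
  induction n with
  | zero => intro y x hx; simp [bl] at hx
  | succ n ih =>
    intro y x hx
    simp only [bl, List.mem_append, List.mem_replicate] at hx
    push_cast
    rcases hx with ⟨_, rfl⟩ | hx
    · omega
    · have := ih x hx; omega

lemma bl_sorted {η : ℤ → ℕ} {n : ℕ} : ∀ {y : ℤ}, (bl η y n).Pairwise (· ≤ ·) := by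
  induction n with
  | zero => intro y; simp [bl]
  | succ n ih =>
    intro y
    simp only [bl]
    rw [List.pairwise_append]
    refine ⟨?_, ih, ?_⟩
    · rw [List.pairwise_replicate]; simp
    · intro a ha b hb
      have h1 := (List.mem_replicate.1 ha).2
      have := bl_mem b hb
      omega

lemma bl_count {η : ℤ → ℕ} {n : ℕ} : ∀ {y x : ℤ}, y < x → x ≤ y + n → (bl η y n).count x = η x := by
  induction n with
  | zero => intro y x h1 h2; simp at h2; omega
  | succ n ih =>
    intro y x h1 h2
    push_cast at h2
    simp only [bl, List.count_append, List.count_replicate]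
    by_cases hx : x = y + 1
    · subst hx
      have : (bl η (y + 1) n).count (y + 1) = 0 := List.count_eq_zero_of_not_mem fun hm => by
        have := bl_mem _ hm; omega
      simp [this]
    · rw [ih (by omega) (by omega)]
      simp [Ne.symm hx]

/-- the `i`-th element is at least `(i + j + 1) m` -/
def Spr (m : ℕ) : ℕ → List ℤ → Prop
  | _, [] => True
  | j, x :: l => ((j + 1 : ℕ) : ℤ) * m ≤ x ∧ Spr m (j + 1) l

lemma Spr_append {m : ℕ} {x : ℤ} {l : List ℤ} (k : ℕ) : ∀ (j : ℕ), (0 < k → ((j + k : ℕ) : ℤ) * m ≤ x) →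
    Spr m (j + k) l → Spr m j (List.replicate k x ++ l) := by
  induction k with
  | zero => intro j _ h; simpa using h
  | succ k ih =>
    intro j h1 h2
    rw [List.replicate_succ, List.cons_append]
    refine ⟨?_, ih (j + 1) ?_ ?_⟩
    · refine le_trans ?_ (h1 (by omega))
      exact mul_le_mul_of_nonneg_right (by exact_mod_cast (by omega)) (by positivity)
    · intro _; have := h1 (by omega); rwa [show j + 1 + k = j + (k + 1) by ring]
    · rwa [show j + 1 + k = j + (k + 1) by ring]

/-- number of particles in `[1, n]` -/
def SS (η : ℤ → ℕ) (n : ℕ) : ℕ := ∑ i ∈ Finset.range n, η ((i : ℤ) + 1)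

lemma Spr_bl {η : ℤ → ℕ} {m : ℕ} (h : ∀ n, m * SS η n ≤ n) (n : ℕ) :
    ∀ y : ℕ, Spr m (SS η y) (bl η y n) := by
  induction n with
  | zero => intro y; trivial
  | succ n ih =>
    intro y
    simp only [bl]
    have e : SS η (y + 1) = SS η y + η ((y : ℤ) + 1) := by simp [SS, Finset.sum_range_succ]
    refine Spr_append _ _ ?_ ?_
    · intro _
      rw [← e]
      have := h (y + 1)
      have : ((m * SS η (y + 1) : ℕ) : ℤ) ≤ ((y + 1 : ℕ) : ℤ) := by exact_mod_cast this
      push_cast at this ⊢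
      linarith
    · rw [← e]
      have := ih (y + 1)
      push_cast at this
      exact this

lemma RR_le {ε : ℝ} (h0 : 0 < ε) (h1 : ε ≤ 1 / 2) {m : ℕ} (hm : (256 : ℝ) ≤ pE ε ^ m) (l : List ℤ) :
    ∀ j, Spr m j l → RR ε 0 l ≤ ((1 : ℝ) / 256) ^ j * (1 / 237) := by
  have hE := pE_pos h0 h1
  induction l with
  | nil => intro j _; simp only [RR]; positivity
  | cons x l ih =>
    intro j h
    obtain ⟨h2, h3⟩ := h
    have h4 := ih _ h3
    have h5 : pE ε ^ (0 - x) ≤ (1 / 256) ^ (j + 1) := by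
      calc pE ε ^ (0 - x) ≤ pE ε ^ (-(((j + 1 : ℕ) : ℤ) * m)) := by
            refine zpow_le_zpow_right₀ ?_ (by omega)
            have := pE_ge h0 h1; linarith
        _ = ((pE ε ^ m)⁻¹) ^ (j + 1) := by
            rw [zpow_neg, mul_comm, zpow_mul, zpow_natCast, zpow_natCast, inv_pow]
        _ ≤ (1 / 256) ^ (j + 1) := by
            refine pow_le_pow_left₀ (by positivity) ?_ _
            rw [inv_eq_one_div]
            exact one_div_le_one_div_of_le (by norm_num) hm
    simp only [RR]
    rw [pow_succ] at h4 h5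
    have : (0 : ℝ) < (1 / 256) ^ j := by positivity
    linarith

/-! ### Reflection -/

def Jneg (J : ℤ → ℕ → Option ℤ) (y : ℤ) (k : ℕ) : Option ℤ := (J (-y) k).map (fun z => -z)

lemma Jneg_NN {J : ℤ → ℕ → Option ℤ} (h : NN J) : NN (Jneg J) := by
  intro y k
  rcases h (-y) k with h | h | h <;> simp [Jneg, h]

lemma map_neg_eq {v : Option ℤ} {z : ℤ} : v.map (fun z => -z) = some z ↔ v = some (-z) := by
  cases v with
  | none => simp
  | some w => simp; omega

lemma cR_neg (J : ℤ → ℕ → Option ℤ) (y : ℤ) (n : ℕ) : cR (Jneg J) y n = cL J (-y) n := by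
  unfold cR cL
  congr 1
  ext k
  simp only [Finset.mem_filter, Jneg, map_neg_eq]

lemma cL_neg (J : ℤ → ℕ → Option ℤ) (y : ℤ) (n : ℕ) : cL (Jneg J) y n = cR J (-y) n := by
  unfold cR cL
  congr 1
  ext k
  simp only [Finset.mem_filter, Jneg, map_neg_eq, neg_neg]

lemma Hh_neg (J : ℤ → ℕ → Option ℤ) (η u : ℤ → ℕ) (y : ℤ) :
    Hh (Jneg J) (fun z => η (-z)) u y = Hh J η (fun z => u (-z)) (-y) := by
  simp only [Hh, cR_neg, cL_neg, neg_neg]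
  rw [show -(y - 1) = -y + 1 by ring, show -(y + 1) = -y - 1 by ring]
  rw [show -(-y + 1) = y - 1 by ring, show -(-y - 1) = y + 1 by ring]
  ring

lemma Hh_congr {J : ℤ → ℕ → Option ℤ} {η u v : ℤ → ℕ} {y : ℤ} (h1 : u (y - 1) = v (y - 1))
    (h2 : u y = v y) (h3 : u (y + 1) = v (y + 1)) : Hh J η u y = Hh J η v y := by
  simp only [Hh, h1, h2, h3]

/-- box -/
noncomputable def box (L : ℕ) : Finset (Site 1) := (Finset.Icc (-(L : ℤ)) L).image st

lemma mem_box {L : ℕ} {y : ℤ} : st y ∈ box L ↔ -(L : ℤ) ≤ y ∧ y ≤ L := by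
  unfold box
  rw [Finset.mem_image]
  constructor
  · rintro ⟨z, hz, h⟩; rw [st_inj] at h; subst h; exact Finset.mem_Icc.1 hz
  · intro h; exact ⟨y, Finset.mem_Icc.2 h, rfl⟩

lemma box_mono {L K : ℕ} (h : L ≤ K) : box L ⊆ box K := by
  intro x hx
  rw [← st_eta x, mem_box] at hx ⊢
  omega

lemma subset_box (V : Finset (Site 1)) : ∃ L, V ⊆ box L := by
  refine ⟨V.sup fun x => (x 0).natAbs, fun x hx => ?_⟩
  have := Finset.le_sup (f := fun x : Site 1 => (x 0).natAbs) hx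
  rw [← st_eta x, mem_box]
  omega

lemma combine {I : Stacks 1} {η : Site 1 → ℕ} (hN : NN (Jof I)) (hη : η (st 0) = 0) {L : ℕ}
    {uR uL : ℤ → ℕ}
    (hR : ∀ y, 1 ≤ y → y ≤ (L : ℤ) → OKs (Jof I) (fun z => η (st z)) uR y)
    (hR' : Supp (Jof I) L uR)
    (hL : ∀ y, 1 ≤ y → y ≤ (L : ℤ) → OKs (Jneg (Jof I)) (fun z => η (st (-z))) uL y)
    (hL' : Supp (Jneg (Jof I)) L uL)
    {l : List (Site 1)} (hl : Legal (box L) I (initState 1 (box L) η) l) :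
    l.count (st 0) = 0 := by
  set u : ℤ → ℕ := fun x => if 0 < x then uR x else uL (-x) with hu
  have uR0 := hR'.1 0 (by simp)
  have uL0 := hL'.1 0 (by simp)
  have upos : ∀ y, 0 ≤ y → u y = uR y := by
    intro y hy
    rcases hy.lt_or_eq with h | h
    · simp [hu, h]
    · subst h; simp [hu, uR0, uL0]
  have uneg : ∀ y, y ≤ 0 → u y = uL (-y) := by
    intro y hy
    simp [hu, not_lt.2 hy]
  have key := least_action hN u (fun y hy => ?_) l _ (LInv_init (box L) I η) hl (fun y => by
    simp [initState]) 0
  · rw [run_snd] at key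
    rw [upos 0 le_rfl, uR0] at key
    omega
  · rw [mem_box] at hy
    rcases lt_trichotomy y 0 with h | h | h
    · have := hL (-y) (by omega) (by omega)
      unfold OKs at this
      rw [Hh_neg (Jof I) (fun z => η (st z)), neg_neg] at this
      rw [Hh_congr (v := fun z => uL (-z)) (uneg _ (by omega)) (uneg _ (by omega))
        (uneg _ (by omega))]
      rcases this with h' | ⟨h', k, hk, hk'⟩
      · exact Or.inl h'
      · refine Or.inr ⟨h', k, by rw [uneg _ h.le]; exact hk, ?_⟩
        simpa [Jneg] using hk'
    · subst h
      left
      have e1 := hR'.2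
      have e2 := hL'.2
      rw [cL_neg] at e2
      have u0 : u 0 = 0 := by rw [upos 0 le_rfl, uR0]
      have u1 : u (0 + 1) = uR 1 := upos _ (by norm_num)
      have u2 : u (0 - 1) = uL 1 := uneg _ (by norm_num)
      simp only [Hh, hη, u0, u1, u2, cR_zero, cL_zero]
      simp only [zero_add, zero_sub, e1, e2]
      simp
    · rw [Hh_congr (v := uR) (upos _ (by omega)) (upos _ (by omega))
        (upos _ (by omega)), upos _ h.le]
      exact hR y (by omega) hy.2

/-! ### Cylinder bounds -/

lemma instrWeight_st {ε : ℝ} (v : Option ℤ) :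
    instrWeight (ssrwStep 1) (ε ^ 2) (v.map st) = ENNReal.ofReal (Wt ε v) := by
  cases v with
  | none => simp [instrWeight, Wt, lamS]
  | some z =>
    simp only [Option.map_some, instrWeight, Wt, lamJ, ssrwStep]
    rw [← ENNReal.ofReal_mul (by positivity)]
    congr 1
    have : (∑ i : Fin 1, (st z i).natAbs) = 1 ↔ (z = 1 ∨ z = -1) := by
      simp [st]; omega
    simp only [this]
    split_ifs
    · simp; ring
    · simp

lemma Jof_eq_iff {I : Stacks 1} {y : ℤ} {k : ℕ} {v : Option ℤ} :
    Jof I y k = v ↔ I (st y, k) = v.map st := by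
  unfold Jof
  cases hI : I (st y, k) with
  | none => cases v <;> simp
  | some z =>
    cases v with
    | none => simp
    | some w =>
      simp only [Option.map_some, Option.some_inj]
      constructor
      · rintro rfl; exact (st_eta z).symm
      · rintro rfl; rfl

lemma cyl_R {ε : ℝ} {μ : Measure (Stacks 1)} (hμ : IsStackLaw 1 (ssrwStep 1) (ε ^ 2) μ)
    (Γ : Finset (ℤ × ℕ)) (g : ℤ × ℕ → Option ℤ) :
    μ {I | ∀ i ∈ Γ, Jof I i.1 i.2 = g i} = ENNReal.ofReal (∏ i ∈ Γ, Wt ε (g i)) := by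
  have h := hμ.2 (Γ.image fun i => (st i.1, i.2)) (fun i => (g (i.1 0, i.2)).map st)
  have e : {I : Stacks 1 | ∀ i ∈ Γ, Jof I i.1 i.2 = g i} =
      {I : Stacks 1 | ∀ i ∈ Γ.image fun i : ℤ × ℕ => (st i.1, i.2),
        I i = (g (i.1 0, i.2)).map st} := by
    ext I
    simp only [Set.mem_ofPred_eq, Finset.forall_mem_image, Jof_eq_iff]
    rfl
  rw [e, h, Finset.prod_image, ENNReal.ofReal_prod_of_nonneg (fun _ _ => Wt_nonneg _ _)]
  · refine Finset.prod_congr rfl fun i _ => ?_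
    exact instrWeight_st _
  · intro i _ j _ hij
    have h1 := (Prod.ext_iff.1 hij).1
    have h2 := (Prod.ext_iff.1 hij).2
    exact Prod.ext (st_inj.1 h1) h2

lemma Wt_neg (ε : ℝ) (v : Option ℤ) : Wt ε (v.map fun z => -z) = Wt ε v := by
  cases v with
  | none => rfl
  | some z =>
    simp only [Option.map_some, Wt]
    have : (-z = 1 ∨ -z = -1) ↔ (z = 1 ∨ z = -1) := by omega
    simp only [this]

lemma cyl_L {ε : ℝ} {μ : Measure (Stacks 1)} (hμ : IsStackLaw 1 (ssrwStep 1) (ε ^ 2) μ)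
    (Γ : Finset (ℤ × ℕ)) (g : ℤ × ℕ → Option ℤ) :
    μ {I | ∀ i ∈ Γ, Jneg (Jof I) i.1 i.2 = g i} = ENNReal.ofReal (∏ i ∈ Γ, Wt ε (g i)) := by
  have h := cyl_R hμ (Γ.image fun i => (-i.1, i.2)) (fun i => (g (-i.1, i.2)).map fun z => -z)
  have e : {I : Stacks 1 | ∀ i ∈ Γ, Jneg (Jof I) i.1 i.2 = g i} =
      {I : Stacks 1 | ∀ i ∈ Γ.image fun i : ℤ × ℕ => (-i.1, i.2),
        Jof I i.1 i.2 = (g (-i.1, i.2)).map fun z => -z} := by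
    ext I
    simp only [Set.mem_ofPred_eq, Finset.forall_mem_image, Jneg, neg_neg, Prod.mk.eta]
    refine forall₂_congr fun i _ => ?_
    generalize Jof I (-i.1) i.2 = a
    generalize g i = b
    cases a <;> cases b <;> simp
    omega
  rw [e, h, Finset.prod_image]
  · congr 1
    refine Finset.prod_congr rfl fun i _ => ?_
    rw [Wt_neg]; simp
  · intro i _ j _ hij
    have h1 := (Prod.ext_iff.1 hij).1
    have h2 := (Prod.ext_iff.1 hij).2
    simp only [neg_inj] at h1
    exact Prod.ext h1 h2

/-- good initial configurations -/
def GoodEta (m : ℕ) (η : Site 1 → ℕ) : Prop :=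
  η (st 0) = 0 ∧ (∀ n, m * SS (fun z => η (st z)) n ≤ n) ∧ ∀ n, m * SS (fun z => η (st (-z))) n ≤ n

theorem good_bound {ε : ℝ} (h0 : 0 < ε) (h1 : ε ≤ 1 / 2) {m : ℕ} (hm : (256 : ℝ) ≤ pE ε ^ m)
    {μ : Measure (Stacks 1)} (hμ : IsStackLaw 1 (ssrwStep 1) (ε ^ 2) μ)
    (hNN : ∀ᵐ I ∂μ, NN (Jof I)) {η : Site 1 → ℕ} (hη : GoodEta m η) :
    μ {I | odom0 I η = ⊤} ≤ ENNReal.ofReal (1 / 5) := by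
  obtain ⟨e0, eR, eL⟩ := hη
  set B : ℕ → Set (Stacks 1) := fun L =>
    {I | NN (Jof I) ∧ ∃ l, Legal (box L) I (initState 1 (box L) η) l ∧ 1 ≤ l.count (st 0)} with hB
  have hmono : Monotone B := by
    rintro L K hLK I ⟨hN, l, hl, hc⟩
    exact ⟨hN, l, legal_init_mono (box_mono hLK) hN hl, hc⟩
  have hsub : ({I | odom0 I η = ⊤} : Set (Stacks 1)) ≤ᵐ[μ] (⋃ L, B L : Set (Stacks 1)) := by
    filter_upwards [hNN] with I hN hI
    change I ∈ (⋃ L, B L : Set (Stacks 1))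
    have hI' : odomAt 0 I η = ⊤ := hI
    obtain ⟨V, l, hl, hc⟩ := odomAt_top_iff.1 hI' 1
    obtain ⟨L, hVL⟩ := subset_box V
    exact Set.mem_iUnion.2 ⟨L, hN, l, legal_init_mono hVL hN hl, hc⟩
  refine (measure_mono_ae hsub).trans ?_
  rw [hmono.measure_iUnion]
  refine iSup_le fun L => ?_
  have side : ∀ (J : Stacks 1 → ℤ → ℕ → Option ℤ) (ζ : ℤ → ℕ), (∀ n, m * SS ζ n ≤ n) →
      (∀ (Γ : Finset (ℤ × ℕ)) (g : ℤ × ℕ → Option ℤ),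
        μ {ω | ∀ i ∈ Γ, J ω i.1 i.2 = g i} = ENNReal.ofReal (∏ i ∈ Γ, Wt ε (g i))) →
      (∀ᵐ ω ∂μ, NN (J ω)) →
      μ {ω | ∀ n, ¬ isDone (runN L (J ω) n (start 0 (fun _ => 0) (bl ζ 0 L)))} ≤
        ENNReal.ofReal (1 / 10) := by
    intro J ζ hζ hc hJ
    refine (prob_fail h0 h1 μ J (fun Γ g => (hc Γ g).le) hJ (by positivity) (bl ζ 0 L)
      bl_sorted (fun y hy => ?_)).trans ?_
    · have := bl_mem y hy; omega
    · refine ENNReal.ofReal_le_ofReal ?_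
      have h2 := Spr_bl hζ L 0
      have := RR_le h0 h1 hm _ _ h2
      simp [SS] at this
      linarith
  have s1 := side (fun I => Jof I) _ eR (cyl_R hμ) hNN
  have s2 := side (fun I => Jneg (Jof I)) _ eL (cyl_L hμ) (hNN.mono fun I h => Jneg_NN h)
  have hBsub : B L ⊆ {ω | ∀ n, ¬ isDone (runN L (Jof ω) n (start 0 (fun _ => 0)
      (bl (fun z => η (st z)) 0 L)))} ∪ {ω | ∀ n, ¬ isDone (runN L (Jneg (Jof ω)) n
        (start 0 (fun _ => 0) (bl (fun z => η (st (-z))) 0 L)))} := by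
    rintro I ⟨hN, l, hl, hc⟩
    by_contra hcon
    rw [Set.mem_union, not_or] at hcon
    obtain ⟨c1, c2⟩ := hcon
    have d1 : ¬ (I ∈ {ω | ∀ n, ¬ isDone (runN L (Jof ω) n (start 0 (fun _ => 0)
      (bl (fun z => η (st z)) 0 L)))}) := c1
    have d2 : ¬ (I ∈ {ω | ∀ n, ¬ isDone (runN L (Jneg (Jof ω)) n (start 0 (fun _ => 0)
      (bl (fun z => η (st (-z))) 0 L)))}) := c2
    simp only [Set.mem_ofPred_eq, not_forall, not_not] at d1 d2
    obtain ⟨n1, d1⟩ := d1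
    obtain ⟨n2, d2⟩ := d2
    have hmem : ∀ (ζ : ℤ → ℕ), ∀ y ∈ bl ζ 0 L, 0 < y ∧ y ≤ (L : ℤ) := by
      intro ζ y hy; have := bl_mem y hy; omega
    have hcnt : ∀ (ζ : ℤ → ℕ), ∀ y, 0 < y → y ≤ (L : ℤ) → (bl ζ 0 L).count y = ζ y := by
      intro ζ y hy hy'; exact bl_count hy (by omega)
    obtain ⟨uR, hR, hR'⟩ := done_spec hN bl_sorted (hmem _) (hcnt _) d1
    obtain ⟨uL, hL, hL'⟩ := done_spec (Jneg_NN hN) bl_sorted (hmem _) (hcnt _) d2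
    have := combine hN e0 hR hR' hL hL' hl
    omega
  refine (measure_mono hBsub).trans ((measure_union_le _ _).trans ((add_le_add s1 s2).trans ?_))
  rw [← ENNReal.ofReal_add (by norm_num) (by norm_num)]
  norm_num

end ARWp
namespace ARWp

instance : MeasurableSingletonClass (Instr 1) := ⟨fun _ => trivial⟩
instance : Countable (Instr 1) := inferInstanceAs (Countable (Option (Fin 1 → ℤ)))
instance : DiscreteMeasurableSpace (Instr 1) := ⟨fun _ => trivial⟩

/-- One-instruction law. -/
noncomputable def kapI (ε : ℝ) : Measure (Instr 1) :=
  ENNReal.ofReal (Wt ε none) • Measure.dirac none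
    + (ENNReal.ofReal (Wt ε (some 1)) • Measure.dirac (some (st 1))
    + ENNReal.ofReal (Wt ε (some (-1))) • Measure.dirac (some (st (-1))))

lemma instr_cases (v : Instr 1) : ∃ w : Option ℤ, v = w.map st := by
  cases v with
  | none => exact ⟨none, rfl⟩
  | some z => exact ⟨some (z 0), by simp [st_eta]⟩

lemma kapI_univ {ε : ℝ} (h0 : 0 < ε) : kapI ε Set.univ = 1 := by
  simp only [kapI, Measure.add_apply, Measure.smul_apply, smul_eq_mul, measure_univ, mul_one]
  have hp : ∀ v, 0 ≤ Wt ε v := by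
    intro v
    unfold Wt
    split <;> (try split_ifs) <;> positivity
  rw [← ENNReal.ofReal_add (hp _) (hp _), ← ENNReal.ofReal_add (hp _) (by have := hp (some 1); have := hp (some (-1)); linarith)]
  rw [ENNReal.ofReal_eq_one]
  simp [Wt]
  field_simp
  try ring

lemma kapI_prob {ε : ℝ} (h0 : 0 < ε) : IsProbabilityMeasure (kapI ε) := ⟨kapI_univ h0⟩

lemma kapI_singleton {ε : ℝ} (v : Instr 1) :
    kapI ε {v} = instrWeight (ssrwStep 1) (ε^2) v := by
  obtain ⟨w, rfl⟩ := instr_cases v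
  rw [instrWeight_st]
  simp only [kapI, Measure.add_apply, Measure.smul_apply, smul_eq_mul]
  rw [Measure.dirac_apply' _ (by trivial), Measure.dirac_apply' _ (by trivial),
    Measure.dirac_apply' _ (by trivial)]
  cases w with
  | none => simp
  | some z =>
    have h1 : (st 1 = st z) ↔ z = 1 := ⟨fun h => (st_inj.1 h).symm, fun h => by rw [h]⟩
    have h2 : (st (-1) = st z) ↔ z = -1 := ⟨fun h => (st_inj.1 h).symm, fun h => by rw [h]⟩
    by_cases c1 : z = 1
    · subst c1
      have : ¬ (st (-1) = st 1) := by rw [h2]; norm_num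
      simp [this]
    · by_cases c2 : z = -1
      · subst c2
        have : ¬ (st (1) = st (-1)) := by rw [h1]; norm_num
        simp [this]
      · have a1 : ¬ (st 1 = st z) := by rwa [h1]
        have a2 : ¬ (st (-1) = st z) := by rwa [h2]
        simp [a1, a2, Wt, c1, c2]

/-- The product law. -/
noncomputable def mu (ε : ℝ) : Measure (Stacks 1) :=
  Measure.infinitePi (fun _ : Site 1 × ℕ => kapI ε)

lemma mu_prob {ε : ℝ} (h0 : 0 < ε) : IsProbabilityMeasure (mu ε) := by
  have := kapI_prob h0
  unfold mu; infer_instance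

lemma mu_isStackLaw {ε : ℝ} (h0 : 0 < ε) : IsStackLaw 1 (ssrwStep 1) (ε^2) (mu ε) := by
  have := kapI_prob h0
  refine ⟨mu_prob h0, fun F g => ?_⟩
  have := Measure.infinitePi_pi (μ := fun _ : Site 1 × ℕ => kapI ε) (s := F)
    (t := fun i => {g i}) (fun i _ => by trivial)
  unfold mu
  have e : {I : Stacks 1 | ∀ i ∈ F, I i = g i} = Set.pi F (fun i => {g i}) := by
    ext I; simp [Set.pi]
  rw [e, this]
  exact Finset.prod_congr rfl fun i _ => kapI_singleton _

lemma stackLaw_unique {ε : ℝ} (h0 : 0 < ε) {μ : Measure (Stacks 1)}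
    (hμ : IsStackLaw 1 (ssrwStep 1) (ε^2) μ) : μ = mu ε := by
  have := kapI_prob h0
  have := hμ.1
  have := mu_prob h0
  have key : ∀ F : Finset (Site 1 × ℕ), μ.map F.restrict = (mu ε).map F.restrict := by
    intro F
    refine Measure.ext_of_singleton ?_
    intro g
    have hr : Measurable (F.restrict (π := fun _ : Site 1 × ℕ => Instr 1)) :=
      Finset.measurable_restrict F
    rw [Measure.map_apply hr (measurableSet_singleton _),
      Measure.map_apply hr (measurableSet_singleton _)]
    classical
    let g' : Site 1 × ℕ → Instr 1 := fun i => if h : i ∈ F then g ⟨i, h⟩ else none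
    have e : F.restrict (π := fun _ : Site 1 × ℕ => Instr 1) ⁻¹' {g} =
        {I : Stacks 1 | ∀ i ∈ F, I i = g' i} := by
      ext I
      simp only [Set.mem_preimage, Set.mem_singleton_iff, Set.mem_ofPred_eq, funext_iff]
      constructor
      · intro h i hi
        have := h ⟨i, hi⟩
        simp [g', hi]; exact this
      · rintro h ⟨i, hi⟩
        have := h i hi
        simp [g', hi] at this; exact this
    rw [e, hμ.2, (mu_isStackLaw h0).2]
  have h2 : IsProjectiveLimit (mu ε) (fun F => (mu ε).map F.restrict) := fun F => rfl
  have : ∀ F : Finset (Site 1 × ℕ), IsFiniteMeasure ((mu ε).map (F.restrict (π := fun _ : Site 1 × ℕ => Instr 1))) :=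
    fun F => inferInstance
  exact IsProjectiveLimit.unique (P := fun F => (mu ε).map F.restrict) key h2

lemma stackLaw_eq {ε : ℝ} (h0 : 0 < ε) : stackLaw 1 (ssrwStep 1) (ε^2) = mu ε := by
  have h : ∃ μ, IsStackLaw 1 (ssrwStep 1) (ε^2) μ := ⟨_, mu_isStackLaw h0⟩
  unfold stackLaw
  rw [dif_pos h]
  exact stackLaw_unique h0 h.choose_spec

lemma mu_NN {ε : ℝ} (h0 : 0 < ε) : ∀ᵐ I ∂(mu ε), NN (Jof I) := by
  have := kapI_prob h0
  have key : ∀ i : Site 1 × ℕ, ∀ᵐ I ∂(mu ε), I i = none ∨ I i = some (st 1) ∨ I i = some (st (-1)) := by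
    intro i
    have hp := measurePreserving_eval_infinitePi (fun _ : Site 1 × ℕ => kapI ε) i
    have : ∀ᵐ v ∂(kapI ε), v = none ∨ v = some (st 1) ∨ v = some (st (-1)) := by
      rw [ae_iff]
      simp only [kapI, Measure.add_apply, Measure.smul_apply, smul_eq_mul]
      rw [Measure.dirac_apply' _ (by trivial), Measure.dirac_apply' _ (by trivial),
        Measure.dirac_apply' _ (by trivial)]
      simp
    exact hp.quasiMeasurePreserving.ae this
  rw [← ae_all_iff] at key
  filter_upwards [key] with I hI
  intro y k
  rcases hI (st y, k) with h | h | h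
  · left; simp [Jof, h]
  · right; left; simp [Jof, h]; rfl
  · right; right; simp [Jof, h]; rfl

lemma mu_inf {ε : ℝ} (h0 : 0 < ε) (y v : ℤ) (hv : v = 1 ∨ v = -1) (k0 : ℕ) :
    ∀ᵐ I ∂(mu ε), ∃ k ≥ k0, Jof I y k = some v := by
  have := kapI_prob h0
  have := mu_prob h0
  rw [ae_iff]
  set a := kapI ε {some (st v)}ᶜ with ha
  have ha1 : a < 1 := by
    rw [ha, prob_compl_eq_one_sub (by trivial), kapI_singleton]
    have := instrWeight_st (ε := ε) (some v)
    simp only [Option.map_some] at this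
    rw [this]
    refine ENNReal.sub_lt_self (by simp) (by simp) ?_
    have : 0 < Wt ε (some v) := by
      simp only [Wt, if_pos hv]; positivity
    simpa using this
  have hb : ∀ n : ℕ, mu ε {I | ¬ ∃ k ≥ k0, Jof I y k = some v} ≤ a ^ n := by
    intro n
    let F : Finset (Site 1 × ℕ) := (Finset.range n).map
      ⟨fun k => (st y, k0 + k), fun i j h => by simpa using h⟩
    have := Measure.infinitePi_pi (μ := fun _ : Site 1 × ℕ => kapI ε) (s := F)
      (t := fun i => {some (st v)}ᶜ) (fun i _ => by trivial)
    rw [Finset.prod_const] at this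
    have hc : F.card = n := by simp [F]
    rw [hc] at this
    rw [ha, ← this]
    refine measure_mono ?_
    intro I hI i hi
    have hI' : ¬ ∃ k ≥ k0, Jof I y k = some v := hI
    simp only [F, Finset.coe_map, Set.mem_image] at hi
    obtain ⟨k, hk, rfl⟩ := hi
    intro h
    refine hI' ⟨k0 + k, by omega, ?_⟩
    rw [Jof_eq_iff]
    exact h
  exact le_antisymm (ge_of_tendsto' (ENNReal.tendsto_pow_atTop_nhds_zero_of_lt_one ha1) hb) bot_le

lemma mu_Rich {ε : ℝ} (h0 : 0 < ε) : ∀ᵐ I ∂(mu ε), Rich (Jof I) := by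
  have h1 : ∀ᵐ I ∂(mu ε), ∀ y : ℤ, ∀ k0 : ℕ, ∃ k ≥ k0, Jof I y k = some 1 := by
    rw [ae_all_iff]; intro y; rw [ae_all_iff]; intro k0
    exact mu_inf h0 y 1 (Or.inl rfl) k0
  have h2 : ∀ᵐ I ∂(mu ε), ∀ y : ℤ, ∀ k0 : ℕ, ∃ k ≥ k0, Jof I y k = some (-1) := by
    rw [ae_all_iff]; intro y; rw [ae_all_iff]; intro k0
    exact mu_inf h0 y (-1) (Or.inr rfl) k0
  filter_upwards [h1, h2] with I h1 h2
  intro y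
  constructor
  · intro N
    induction N with
    | zero => exact ⟨0, Nat.zero_le _⟩
    | succ N ih =>
      obtain ⟨n, hn⟩ := ih
      obtain ⟨k, hk, hk'⟩ := h1 y n
      refine ⟨k + 1, ?_⟩
      rw [cR_succ, if_pos hk']
      have := cR_mono (Jof I) y hk
      omega
  · intro N
    induction N with
    | zero => exact ⟨0, Nat.zero_le _⟩
    | succ N ih =>
      obtain ⟨n, hn⟩ := ih
      obtain ⟨k, hk, hk'⟩ := h2 y n
      refine ⟨k + 1, ?_⟩
      rw [cL_succ, if_pos hk']
      have := cL_mono (Jof I) y hk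
      omega

end ARWp
namespace ARWp

/-- shift of stacks -/
def shI (z : Site 1) (I : Stacks 1) : Stacks 1 := fun i => I (i.1 + z, i.2)

/-- shift of a state -/
def shS (z : Site 1) (s : State 1) : State 1 := (fun x => s.1 (x + z), fun x => s.2 (x + z))

lemma upd_shift {β : Type*} (z x : Site 1) (f : Site 1 → β) (b : β) :
    (fun y => Function.update f (x + z) b (y + z)) = Function.update (fun y => f (y + z)) x b := by
  funext y
  by_cases h : y = x
  · subst h; simp
  · have : y + z ≠ x + z := fun h' => h (add_right_cancel h')
    simp [Function.update_of_ne h, Function.update_of_ne this]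

lemma topple_sh (z : Site 1) (V V' : Finset (Site 1)) (hV : ∀ x, x ∈ V' ↔ x + z ∈ V)
    (I : Stacks 1) (x : Site 1) (s : State 1) :
    topple V' (shI z I) x (shS z s) = shS z (topple V I (x + z) s) := by
  unfold topple shS
  refine Prod.ext ?_ (upd_shift z x s.2 _).symm
  simp only [shI]
  cases h : I (x + z, s.2 (x + z)) with
  | none =>
    simp only
    split_ifs with h1
    · exact (upd_shift z x s.1 _).symm
    · rfl
  | some w =>
    simp only [hV, add_right_comm x w z]
    split_ifs with h1
    · rw [← upd_shift z x s.1, add_right_comm x z w, upd_shift z (x + w)]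
    · exact (upd_shift z x s.1 _).symm

lemma legal_sh (z : Site 1) (V V' : Finset (Site 1)) (hV : ∀ x, x ∈ V' ↔ x + z ∈ V)
    (I : Stacks 1) (l : List (Site 1)) : ∀ (s : State 1),
    Legal V' (shI z I) (shS z s) l ↔ Legal V I s (l.map (· + z)) := by
  induction l with
  | nil => intro s; simp [Legal]
  | cons x l ih =>
    intro s
    simp only [Legal, List.map_cons]
    rw [topple_sh z V V' hV, ih, hV]
    rfl

lemma init_sh (z : Site 1) (V V' : Finset (Site 1)) (hV : ∀ x, x ∈ V' ↔ x + z ∈ V)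
    (η : Site 1 → ℕ) : initState 1 V' (shift z η) = shS z (initState 1 V η) := by
  unfold initState shS shift
  refine Prod.ext ?_ rfl
  funext x
  simp only [hV]

lemma odomAt_sh_le (z : Site 1) (I : Stacks 1) (η : Site 1 → ℕ) (y : ℤ) :
    odomAt (y + z 0) I η ≤ odomAt y (shI z I) (shift z η) := by
  conv_lhs => unfold odomAt
  refine iSup_le fun V => iSup_le fun l => iSup_le fun hl => ?_
  classical
  let V' := V.image (· - z)
  have hV : ∀ x, x ∈ V' ↔ x + z ∈ V := by
    intro x
    simp only [V', Finset.mem_image]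
    constructor
    · rintro ⟨a, ha, rfl⟩; simpa using ha
    · intro h; exact ⟨x + z, h, by simp⟩
  have hm : (l.map (· - z)).map (· + z) = l := by
    rw [List.map_map]
    convert List.map_id l using 2
    funext x; simp
  have hl' : Legal V' (shI z I) (initState 1 V' (shift z η)) (l.map (· - z)) := by
    rw [init_sh z V V' hV, legal_sh z V V' hV, hm]; exact hl
  have := le_odomAt (x := y) hl'
  refine le_trans (le_of_eq ?_) this
  congr 1
  have e : st (y + z 0) = st y + z := (st_add y z).symm
  rw [e]
  have := List.count_map_of_injective (l.map (· - z)) (· + z) (add_left_injective z) (st y)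
  rw [hm] at this
  exact this

lemma shI_neg (z : Site 1) (I : Stacks 1) : shI (-z) (shI z I) = I := by
  funext i; simp [shI]

lemma shift_neg (z : Site 1) (η : Site 1 → ℕ) : shift (-z) (shift z η) = η := by
  funext i; simp [shift]

lemma odomAt_sh (z : Site 1) (I : Stacks 1) (η : Site 1 → ℕ) (y : ℤ) :
    odomAt y (shI z I) (shift z η) = odomAt (y + z 0) I η := by
  refine le_antisymm ?_ (odomAt_sh_le z I η y)
  have := odomAt_sh_le (-z) (shI z I) (shift z η) (y + z 0)
  rw [shI_neg, shift_neg] at this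
  simpa using this

lemma measurable_shI (z : Site 1) : Measurable (shI z) :=
  measurable_pi_lambda _ fun _ => measurable_pi_apply _

lemma measurable_shift (z : Site 1) : Measurable (shift (d := 1) z) :=
  measurable_pi_lambda _ fun _ => measurable_pi_apply _

lemma mu_shI {ε : ℝ} (h0 : 0 < ε) (z : Site 1) : (mu ε).map (shI z) = mu ε := by
  have := mu_prob h0
  refine stackLaw_unique h0 ⟨Measure.isProbabilityMeasure_map (measurable_shI z).aemeasurable, ?_⟩
  intro F g
  have hms : MeasurableSet {I : Stacks 1 | ∀ i ∈ F, I i = g i} := by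
    have : {I : Stacks 1 | ∀ i ∈ F, I i = g i} = Set.pi F (fun i => {g i}) := by
      ext I; simp [Set.pi]
    rw [this]
    exact MeasurableSet.pi F.countable_toSet fun i _ => by trivial
  rw [Measure.map_apply (measurable_shI z) hms]
  let e : (Site 1 × ℕ) ↪ (Site 1 × ℕ) := ⟨fun i => (i.1 + z, i.2), fun i j h => by
    simp only [Prod.mk.injEq] at h; exact Prod.ext (add_right_cancel h.1) h.2⟩
  have h2 := (mu_isStackLaw h0).2 (F.map e) (fun i => g (i.1 - z, i.2))
  have e1 : shI z ⁻¹' {I : Stacks 1 | ∀ i ∈ F, I i = g i} =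
      {I : Stacks 1 | ∀ i ∈ F.map e, I i = g (i.1 - z, i.2)} := by
    ext I
    simp only [Set.mem_preimage, Set.mem_ofPred_eq, Finset.mem_map]
    constructor
    · rintro h _ ⟨j, hj, rfl⟩
      change I (j.1 + z, j.2) = g (j.1 + z - z, j.2)
      rw [add_sub_cancel_right]
      exact h j hj
    · intro h i hi
      have := h (e i) ⟨i, hi, rfl⟩
      change I (i.1 + z, i.2) = g (i.1 + z - z, i.2) at this
      rw [add_sub_cancel_right] at this
      exact this
  rw [e1, h2, Finset.prod_map]
  refine Finset.prod_congr rfl fun i _ => ?_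
  change instrWeight _ _ (g (i.1 + z - z, i.2)) = _
  rw [add_sub_cancel_right]

/-! measurability -/

lemma topple_congr {V : Finset (Site 1)} {I I' : Stacks 1} {x : Site 1} {s : State 1}
    (h : I (x, s.2 x) = I' (x, s.2 x)) : topple V I x s = topple V I' x s := by
  unfold topple; simp only [h]

lemma legal_congr {V : Finset (Site 1)} {I I' : Stacks 1} (l : List (Site 1)) : ∀ (s : State 1),
    (∀ x ∈ l, ∀ k < s.2 x + l.length, I (x, k) = I' (x, k)) → Legal V I s l → Legal V I' s l := by
  induction l with
  | nil => intro s _ _; trivial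
  | cons x l ih =>
    intro s h hl
    obtain ⟨h1, h2, h3⟩ := hl
    have e : topple V I x s = topple V I' x s :=
      topple_congr (h x (by simp) _ (by simp))
    refine ⟨h1, h2, ?_⟩
    rw [← e]
    refine ih _ ?_ h3
    intro y hy k hk
    refine h y (by simp [hy]) k (lt_of_lt_of_le hk ?_)
    rw [topple_snd]
    simp only [List.length_cons]
    by_cases c : y = x
    · subst c; simp; omega
    · simp [Function.update_of_ne c]

lemma meas_legal (V : Finset (Site 1)) (l : List (Site 1)) :
    MeasurableSet {p : (Site 1 → ℕ) × Stacks 1 | Legal V p.2 (initState 1 V p.1) l} := by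
  let F : Finset (Site 1 × ℕ) := l.toFinset ×ˢ Finset.range l.length
  let f : (Site 1 → ℕ) × Stacks 1 → (V → ℕ) × (F → Instr 1) :=
    fun p => (fun x => p.1 x, fun i => p.2 i)
  have hf : Measurable f := by
    refine Measurable.prodMk ?_ ?_
    · exact measurable_pi_lambda _ fun i => (measurable_pi_apply _).comp measurable_fst
    · exact measurable_pi_lambda _ fun i => (measurable_pi_apply _).comp measurable_snd
  have e : {p : (Site 1 → ℕ) × Stacks 1 | Legal V p.2 (initState 1 V p.1) l} =
      f ⁻¹' (f '' {p : (Site 1 → ℕ) × Stacks 1 | Legal V p.2 (initState 1 V p.1) l}) := by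
    refine Set.Subset.antisymm (Set.subset_preimage_image _ _) ?_
    rintro p ⟨q, hq, hqp⟩
    have hq' : Legal V q.2 (initState 1 V q.1) l := hq
    change Legal V p.2 (initState 1 V p.1) l
    have a1 : ∀ x ∈ V, q.1 x = p.1 x := fun x hx =>
      congrFun (congrArg Prod.fst hqp) ⟨x, hx⟩
    have a2 : ∀ i ∈ F, q.2 i = p.2 i := fun i hi =>
      congrFun (congrArg Prod.snd hqp) ⟨i, hi⟩
    have e1 : initState 1 V q.1 = initState 1 V p.1 := by
      unfold initState
      refine Prod.ext ?_ rfl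
      funext x
      simp only
      split_ifs with h
      · rw [a1 x h]
      · rfl
    rw [← e1]
    refine legal_congr l _ ?_ hq'
    intro x hx k hk
    refine a2 _ ?_
    simp only [initState, zero_add] at hk
    simp [F, hx, hk]
  rw [e]
  refine hf ?_
  exact MeasurableSet.of_discrete

lemma meas_le_odom (x : ℤ) (n : ℕ) :
    MeasurableSet {p : (Site 1 → ℕ) × Stacks 1 | (n : ℕ∞) ≤ odomAt x p.2 p.1} := by
  rcases Nat.eq_zero_or_pos n with rfl | hn
  · simp
  have : {p : (Site 1 → ℕ) × Stacks 1 | (n : ℕ∞) ≤ odomAt x p.2 p.1} =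
      ⋃ (V : Finset (Site 1)), ⋃ (l : List (Site 1)), ⋃ (_ : n ≤ l.count (st x)),
        {p : (Site 1 → ℕ) × Stacks 1 | Legal V p.2 (initState 1 V p.1) l} := by
    ext p
    simp only [Set.mem_ofPred_eq, Set.mem_iUnion]
    rw [le_odomAt_iff hn]
    simp only [exists_prop, and_comm]
  rw [this]
  exact MeasurableSet.iUnion fun V => MeasurableSet.iUnion fun l => MeasurableSet.iUnion fun _ =>
    meas_legal V l

lemma meas_top (x : ℤ) :
    MeasurableSet {p : (Site 1 → ℕ) × Stacks 1 | odomAt x p.2 p.1 = ⊤} := by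
  have : {p : (Site 1 → ℕ) × Stacks 1 | odomAt x p.2 p.1 = ⊤} =
      ⋂ n : ℕ, {p : (Site 1 → ℕ) × Stacks 1 | (n : ℕ∞) ≤ odomAt x p.2 p.1} := by
    ext p
    simp only [Set.mem_ofPred_eq, Set.mem_iInter]
    constructor
    · intro h n; rw [h]; exact le_top
    · intro h; exact ENat.eq_top_iff_forall_ge.2 h
  rw [this]
  exact MeasurableSet.iInter fun n => meas_le_odom x n

end ARWp
namespace ARWp

lemma indep_dep {ε : ℝ} (h0 : 0 < ε) {S S' : Set (Stacks 1)} {F F' : Finset (Site 1 × ℕ)}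
    (hF : Disjoint F F')
    (hS : ∀ I I' : Stacks 1, (∀ i ∈ F, I i = I' i) → (I ∈ S → I' ∈ S))
    (hS' : ∀ I I' : Stacks 1, (∀ i ∈ F', I i = I' i) → (I ∈ S' → I' ∈ S')) :
    mu ε (S ∩ S') = mu ε S * mu ε S' := by
  have := kapI_prob h0
  have hi := ProbabilityTheory.iIndepFun_infinitePi
    (P := fun _ : Site 1 × ℕ => kapI ε) (X := fun _ => id) (fun _ => measurable_id)
  have hj := hi.indepFun_finset F F' hF (fun i => measurable_pi_apply i)
  have := hj.measure_inter_preimage_eq_mul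
    ((fun (I : Stacks 1) (i : F) => id (I i)) '' S) ((fun (I : Stacks 1) (i : F') => id (I i)) '' S')
    MeasurableSet.of_discrete MeasurableSet.of_discrete
  have e : ∀ (F : Finset (Site 1 × ℕ)) (S : Set (Stacks 1)), (∀ I I' : Stacks 1, (∀ i ∈ F, I i = I' i) → (I ∈ S → I' ∈ S)) →
      (fun (I : Stacks 1) (i : F) => id (I i)) ⁻¹' ((fun (I : Stacks 1) (i : F) => id (I i)) '' S) = S := by
    intro F S hS
    refine Set.Subset.antisymm ?_ (Set.subset_preimage_image _ _)
    rintro I ⟨I', h, h'⟩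
    exact hS I' I (fun i hi => congrFun h' ⟨i, hi⟩) h
  rw [e F S hS, e F' S' hS'] at this
  exact this

/-- the ring of finitely-dependent sets -/
def CC : Set (Set ((Site 1 → ℕ) × Stacks 1)) :=
  {s | MeasurableSet s ∧ ∃ F : Finset (Site 1 × ℕ), ∀ η (I I' : Stacks 1),
    (∀ i ∈ F, I i = I' i) → ((η, I) ∈ s ↔ (η, I') ∈ s)}

lemma CC_ring : IsSetRing CC := by
  classical
  refine ⟨⟨MeasurableSet.empty, ∅, by simp⟩, ?_, ?_⟩
  · rintro s t ⟨hs, F, hF⟩ ⟨ht, G, hG⟩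
    refine ⟨hs.union ht, F ∪ G, fun η I I' h => ?_⟩
    have a := hF η I I' fun i hi => h i (by simp [hi])
    have b := hG η I I' fun i hi => h i (by simp [hi])
    simp only [Set.mem_union, a, b]
  · rintro s t ⟨hs, F, hF⟩ ⟨ht, G, hG⟩
    refine ⟨hs.diff ht, F ∪ G, fun η I I' h => ?_⟩
    have a := hF η I I' fun i hi => h i (by simp [hi])
    have b := hG η I I' fun i hi => h i (by simp [hi])
    simp only [Set.mem_sdiff, a, b]

lemma CC_gen : (inferInstance : MeasurableSpace ((Site 1 → ℕ) × Stacks 1)) =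
    MeasurableSpace.generateFrom CC := by
  refine le_antisymm ?_ (MeasurableSpace.generateFrom_le fun s hs => hs.1)
  refine sup_le ?_ ?_
  · rintro _ ⟨s, hs, rfl⟩
    refine MeasurableSpace.measurableSet_generateFrom ⟨measurable_fst hs, ∅, fun η I I' _ => Iff.rfl⟩
  · rw [← measurable_iff_comap_le]
    refine @measurable_pi_lambda _ _ _ (MeasurableSpace.generateFrom CC) _ _ fun i => ?_
    intro s hs
    refine MeasurableSpace.measurableSet_generateFrom
      ⟨((measurable_pi_apply i).comp measurable_snd) hs, {i}, fun η I I' h => ?_⟩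
    simp only [Set.mem_preimage, h i (by simp)]

/-- joint shift -/
def TT (z : Site 1) (p : (Site 1 → ℕ) × Stacks 1) : (Site 1 → ℕ) × Stacks 1 :=
  (shift z p.1, shI z p.2)

lemma measurable_TT (z : Site 1) : Measurable (TT z) :=
  ((measurable_shift z).comp measurable_fst).prodMk ((measurable_shI z).comp measurable_snd)

lemma TT_mp {ε : ℝ} (h0 : 0 < ε) {ν : Measure (Site 1 → ℕ)} [IsProbabilityMeasure ν]
    (hν : ∀ z, Measure.map (shift z) ν = ν) (z : Site 1) :
    MeasurePreserving (TT z) (ν.prod (mu ε)) (ν.prod (mu ε)) := by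
  have := mu_prob h0
  have h1 : MeasurePreserving (shift z) ν ν := ⟨measurable_shift z, hν z⟩
  have h2 : MeasurePreserving (shI z) (mu ε) (mu ε) := ⟨measurable_shI z, mu_shI h0 z⟩
  exact h1.prod h2

lemma exists_far (F : Finset (Site 1 × ℕ)) : ∃ z : Site 1,
    Disjoint F (F.image (fun i => (i.1 + z, i.2))) := by
  classical
  obtain ⟨N, hN⟩ := Infinite.exists_notMem_finset
    ((F ×ˢ F).image (fun p => p.1.1 0 - p.2.1 0))
  refine ⟨st N, ?_⟩
  rw [Finset.disjoint_left]
  intro i hi hi'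
  simp only [Finset.mem_image] at hi'
  obtain ⟨j, hj, rfl⟩ := hi'
  refine hN ?_
  simp only [Finset.mem_image, Finset.mem_product]
  refine ⟨((j.1 + st N, j.2), j), ⟨hi, hj⟩, ?_⟩
  simp [st]

lemma zero_one {ε : ℝ} (h0 : 0 < ε) {ν : Measure (Site 1 → ℕ)} [IsProbabilityMeasure ν]
    (hν : ∀ z, Measure.map (shift z) ν = ν) {A : Set ((Site 1 → ℕ) × Stacks 1)}
    (hA : MeasurableSet A)
    (hinv : ∀ z, ∀ᵐ p ∂(ν.prod (mu ε)), p ∈ A ↔ TT z p ∈ A) :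
    ∀ᵐ η ∂ν, mu ε (Prod.mk η ⁻¹' A) = 0 ∨ mu ε (Prod.mk η ⁻¹' A) = 1 := by
  classical
  have := mu_prob h0
  set a : (Site 1 → ℕ) → ℝ≥0∞ := fun η => mu ε (Prod.mk η ⁻¹' A) with ha
  have ham : Measurable a := measurable_measure_prodMk_left hA
  have ha1 : ∀ η, a η ≤ 1 := fun η => prob_le_one
  have hPA : ν.prod (mu ε) A = ∫⁻ η, a η ∂ν := Measure.prod_apply hA
  have key : ∀ δ : ℝ≥0∞, 0 < δ → ∫⁻ η, a η ∂ν ≤ ∫⁻ η, a η * a η ∂ν + (δ + δ + (δ + δ)) := by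
    intro δ hδ
    obtain ⟨B, ⟨hB, F, hF⟩, hAB⟩ := exists_measure_symmDiff_lt_of_generateFrom_isSetRing
      (μ := ν.prod (mu ε)) CC_ring
      ⟨{Set.univ}, by simp, by
        rintro _ rfl
        exact ⟨MeasurableSet.univ, ∅, by simp⟩, by simp⟩ CC_gen hA hδ
    obtain ⟨z, hz⟩ := exists_far F
    set B' := TT z ⁻¹' B with hB'
    have hBm' : MeasurableSet B' := measurable_TT z hB
    have d1 : ν.prod (mu ε) (B \ A) ≤ δ := (measure_mono (by
      intro p hp; exact Or.inl hp)).trans hAB.le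
    have d2 : ν.prod (mu ε) (A \ B) ≤ δ := (measure_mono (by
      intro p hp; exact Or.inr hp)).trans hAB.le
    have mp := TT_mp h0 hν z
    have d3 : ν.prod (mu ε) (B' \ A) ≤ δ := by
      have e : ν.prod (mu ε) (B' \ A) = ν.prod (mu ε) (TT z ⁻¹' (B \ A)) := by
        refine measure_congr ?_
        filter_upwards [hinv z] with p hp
        exact propext (and_congr Iff.rfl (not_congr hp))
      rw [e, mp.measure_preimage (hB.diff hA).nullMeasurableSet]; exact d1
    have d4 : ν.prod (mu ε) (A \ B') ≤ δ := by
      have e : ν.prod (mu ε) (A \ B') = ν.prod (mu ε) (TT z ⁻¹' (A \ B)) := by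
        refine measure_congr ?_
        filter_upwards [hinv z] with p hp
        exact propext (and_congr hp Iff.rfl)
      rw [e, mp.measure_preimage (hA.diff hB).nullMeasurableSet]; exact d2
    have sub : A ⊆ (B ∩ B') ∪ ((A \ B) ∪ (A \ B')) := by
      intro p hp
      by_cases c : p ∈ B
      · by_cases c' : p ∈ B'
        · exact Or.inl ⟨c, c'⟩
        · exact Or.inr (Or.inr ⟨hp, c'⟩)
      · exact Or.inr (Or.inl ⟨hp, c⟩)
    have e1 : ν.prod (mu ε) (B ∩ B') ≤ ∫⁻ η, a η * a η ∂ν + (δ + δ) := by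
      rw [Measure.prod_apply (hB.inter hBm')]
      have hpt : ∀ η, mu ε (Prod.mk η ⁻¹' (B ∩ B')) ≤ a η * a η +
          (mu ε (Prod.mk η ⁻¹' (B \ A)) + mu ε (Prod.mk η ⁻¹' (B' \ A))) := by
        intro η
        have hind : mu ε (Prod.mk η ⁻¹' (B ∩ B')) =
            mu ε (Prod.mk η ⁻¹' B) * mu ε (Prod.mk η ⁻¹' B') := by
          rw [Set.preimage_inter]
          refine indep_dep h0 hz ?_ ?_
          · intro I I' h hI
            exact (hF η I I' h).1 hI
          · intro I I' h hI
            refine (hF (shift z η) (shI z I) (shI z I') ?_).1 hI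
            intro i hi
            exact h (i.1 + z, i.2) (Finset.mem_image.2 ⟨i, hi, rfl⟩)
        have b1 : mu ε (Prod.mk η ⁻¹' B) ≤ a η + mu ε (Prod.mk η ⁻¹' (B \ A)) := by
          refine (measure_mono ?_).trans (measure_union_le _ _)
          intro I hI
          by_cases c : (η, I) ∈ A
          · exact Or.inl c
          · exact Or.inr ⟨hI, c⟩
        have b2 : mu ε (Prod.mk η ⁻¹' B') ≤ a η + mu ε (Prod.mk η ⁻¹' (B' \ A)) := by
          refine (measure_mono ?_).trans (measure_union_le _ _)
          intro I hI
          by_cases c : (η, I) ∈ A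
          · exact Or.inl c
          · exact Or.inr ⟨hI, c⟩
        rw [hind]
        set e := mu ε (Prod.mk η ⁻¹' (B \ A))
        set e' := mu ε (Prod.mk η ⁻¹' (B' \ A))
        calc mu ε (Prod.mk η ⁻¹' B) * mu ε (Prod.mk η ⁻¹' B')
            ≤ (a η + e) * mu ε (Prod.mk η ⁻¹' B') := by gcongr
          _ = a η * mu ε (Prod.mk η ⁻¹' B') + e * mu ε (Prod.mk η ⁻¹' B') := add_mul _ _ _
          _ ≤ a η * (a η + e') + e * 1 := by
              gcongr
              exact prob_le_one
          _ = a η * a η + a η * e' + e := by ring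
          _ ≤ a η * a η + 1 * e' + e := by gcongr; exact ha1 η
          _ = a η * a η + (e + e') := by ring
      refine (lintegral_mono hpt).trans ?_
      have haam : Measurable (fun η => a η * a η) := ham.mul ham
      rw [lintegral_add_left haam, lintegral_add_left
        (measurable_measure_prodMk_left (hB.diff hA)), ← Measure.prod_apply (hB.diff hA),
        ← Measure.prod_apply (hBm'.diff hA)]
      gcongr
    rw [← hPA]
    refine (measure_mono sub).trans ((measure_union_le _ _).trans ?_)
    refine (add_le_add e1 ((measure_union_le _ _).trans (add_le_add d2 d4))).trans ?_
    rw [add_assoc]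
  have key2 : ∫⁻ η, a η ∂ν ≤ ∫⁻ η, a η * a η ∂ν := by
    refine ENNReal.le_of_forall_pos_le_add fun δ hδ _ => ?_
    have := key ((δ : ℝ≥0∞) / 4) (by simpa using hδ.ne')
    refine this.trans (le_of_eq ?_)
    congr 1
    have h4 : (δ : ℝ≥0∞) / 4 + δ / 4 + (δ / 4 + δ / 4) = 4 * (δ / 4) := by ring
    rw [h4, ENNReal.mul_div_cancel (by norm_num) (by norm_num)]
  have haa : ∀ η, a η * a η ≤ a η := fun η => by
    calc a η * a η ≤ a η * 1 := by gcongr; exact ha1 η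
      _ = a η := mul_one _
  have fin : ∫⁻ η, a η * a η ∂ν ≠ ⊤ := by
    have : ∫⁻ η, a η * a η ∂ν ≤ ∫⁻ η, 1 ∂ν := lintegral_mono fun η => (haa η).trans (ha1 η)
    simp at this
    exact ne_top_of_le_ne_top one_ne_top this
  have := ae_eq_of_ae_le_of_lintegral_le (Eventually.of_forall haa) fin ham.aemeasurable key2
  filter_upwards [this] with η h
  have hne : a η ≠ ⊤ := ne_top_of_le_ne_top one_ne_top (ha1 η)
  change a η = 0 ∨ a η = 1
  by_cases c : a η = 0
  · exact Or.inl c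
  · right
    have h2 : a η * a η = a η * 1 := by rw [mul_one]; exact h
    exact (ENNReal.mul_right_inj c hne).1 h2

end ARWp
namespace ARWp

lemma odom_top_iff {I : Stacks 1} {η : Site 1 → ℕ} (hN : NN (Jof I)) (hR : Rich (Jof I)) (x y : ℤ) :
    odomAt x I η = ⊤ ↔ odomAt y I η = ⊤ :=
  ⟨odom_all hN hR x y, odom_all hN hR y x⟩

lemma fixates_of {ε : ℝ} (h0 : 0 < ε) (h1 : ε ≤ 1 / 2) {m : ℕ} (hm : (256 : ℝ) ≤ pE ε ^ m)
    {ν : Measure (Site 1 → ℕ)} [IsProbabilityMeasure ν] (hν : IsTransErgodic ν)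
    (hG : ν {η | GoodEta m η} ≠ 0) : Fixates 1 (ssrwStep 1) (ε ^ 2) ν := by
  have := mu_prob h0
  set A : Set ((Site 1 → ℕ) × Stacks 1) := {p | odomAt 0 p.2 p.1 = ⊤} with hA
  have hAm : MeasurableSet A := meas_top 0
  have hz := zero_one h0 hν.1 hAm (by
    intro z
    have h : ∀ᵐ I ∂(mu ε), NN (Jof I) ∧ Rich (Jof I) := (mu_NN h0).and (mu_Rich h0)
    have h' : ∀ᵐ p ∂(ν.prod (mu ε)), NN (Jof p.2) ∧ Rich (Jof p.2) :=
      Measure.quasiMeasurePreserving_snd.ae h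
    filter_upwards [h'] with p hp
    change odomAt 0 p.2 p.1 = ⊤ ↔ odomAt 0 (shI z p.2) (shift z p.1) = ⊤
    rw [odomAt_sh]
    exact odom_top_iff hp.1 hp.2 _ _)
  set a : (Site 1 → ℕ) → ℝ≥0∞ := fun η => mu ε (Prod.mk η ⁻¹' A) with ha
  have ham : Measurable a := measurable_measure_prodMk_left hAm
  have hai : ∀ z η, a (shift z η) = a η := by
    intro z η
    have e1 : a (shift z η) = (mu ε).map (shI z) (Prod.mk (shift z η) ⁻¹' A) := by
      rw [mu_shI h0]
    rw [e1, Measure.map_apply (measurable_shI z) (measurable_prodMk_left hAm)]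
    refine measure_congr ?_
    filter_upwards [mu_NN h0, mu_Rich h0] with I hN hR
    refine propext ?_
    change odomAt 0 (shI z I) (shift z η) = ⊤ ↔ odomAt 0 I η = ⊤
    rw [odomAt_sh]
    exact odom_top_iff hN hR _ _
  have hS : MeasurableSet {η | a η = 0} := ham (measurableSet_singleton 0)
  have hfin : ∀ᵐ η ∂ν, a η = 0 := by
    rcases hν.2 {η | a η = 0} hS (by intro z; ext η; simp [hai]) with h | h
    · exfalso
      apply hG
      have h2 : ∀ᵐ η ∂ν, ¬ a η = 0 := by
        rw [ae_iff]; simpa using h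
      have h3 : ∀ᵐ η ∂ν, ¬ GoodEta m η := by
        filter_upwards [hz, h2] with η c1 c2 c3
        have h5 := good_bound h0 h1 hm (mu_isStackLaw h0) (mu_NN h0) c3
        have h6 : a η ≤ ENNReal.ofReal (1/5) := h5
        have h7 : a η = 1 := by
          rcases c1 with c1 | c1
          · exact absurd c1 c2
          · exact c1
        rw [h7] at h6
        have : ENNReal.ofReal (1/5) < 1 := by
          rw [ENNReal.ofReal_lt_one]; norm_num
        exact absurd h6 (not_le.2 this)
      rw [ae_iff] at h3
      simpa using h3
    · rw [ae_iff]
      have := prob_compl_eq_zero_iff (μ := ν) hS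
      exact this.2 h
  unfold Fixates
  rw [stackLaw_eq h0]
  filter_upwards [hfin] with η h
  rw [ae_iff]
  have h' : mu ε (Prod.mk η ⁻¹' A) = 0 := h
  simp only [ne_eq, not_not]
  exact h'

end ARWp
namespace ARWp

/-- bad point for the greedy covering -/
def Bad (m N : ℕ) (f : ℕ → ℕ) (k : ℕ) : Prop :=
  ∃ n ≤ N, n < m * ∑ i ∈ Finset.range n, f (k + i)

open Classical in
lemma greedy (m N : ℕ) (f : ℕ → ℕ) (M : ℕ) : ∀ j k : ℕ, k + j = M →
    ((Finset.Ico k M).filter (Bad m N f)).card ≤ m * ∑ i ∈ Finset.Ico k (M + N), f i := by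
  intro j
  induction j using Nat.strong_induction_on with
  | _ j ih =>
    intro k hk
    rcases Nat.eq_zero_or_pos j with rfl | hj
    · have : Finset.Ico k M = ∅ := by simp; omega
      simp [this]
    by_cases hb : Bad m N f k
    · obtain ⟨n, hn, hlt⟩ := hb
      have hn0 : 1 ≤ n := by
        rcases Nat.eq_zero_or_pos n with rfl | h
        · simp at hlt
        · exact h
      have e1 : ∑ i ∈ Finset.range n, f (k + i) = ∑ i ∈ Finset.Ico k (k + n), f i := by
        rw [Finset.sum_Ico_eq_sum_range]; simp
      rw [e1] at hlt
      have e2 : ∑ i ∈ Finset.Ico k (M + N), f i = ∑ i ∈ Finset.Ico k (k + n), f i +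
          ∑ i ∈ Finset.Ico (k + n) (M + N), f i :=
        (Finset.sum_Ico_consecutive _ (by omega) (by omega)).symm
      have e3 : ((Finset.Ico k M).filter (Bad m N f)).card ≤ n +
          ((Finset.Ico (k + n) M).filter (Bad m N f)).card := by
        have : (Finset.Ico k M).filter (Bad m N f) ⊆ Finset.Ico k (k + n) ∪
            (Finset.Ico (k + n) M).filter (Bad m N f) := by
          intro x hx
          simp only [Finset.mem_filter, Finset.mem_Ico, Finset.mem_union] at hx ⊢
          by_cases c : x < k + n
          · left; omega
          · right; exact ⟨by omega, hx.2⟩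
        refine (Finset.card_le_card this).trans ((Finset.card_union_le _ _).trans ?_)
        simp
      by_cases c : n ≤ j
      · have := ih (j - n) (by omega) (k + n) (by omega)
        rw [e2, mul_add]
        omega
      · have : Finset.Ico (k + n) M = ∅ := by simp; omega
        rw [this] at e3
        rw [e2, mul_add]
        simp at e3
        omega
    · have := ih (j - 1) (by omega) (k + 1) (by omega)
      have e : (Finset.Ico k M).filter (Bad m N f) = (Finset.Ico (k + 1) M).filter (Bad m N f) := by
        ext x
        simp only [Finset.mem_filter, Finset.mem_Ico]
        constructor
        · rintro ⟨h1, h2⟩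
          have : x ≠ k := by rintro rfl; exact hb h2
          exact ⟨by omega, h2⟩
        · rintro ⟨h1, h2⟩; exact ⟨by omega, h2⟩
      rw [e]
      refine this.trans ?_
      gcongr
      omega

lemma meas_eval (x : Site 1) : Measurable (fun η : Site 1 → ℕ => (η x : ℝ≥0∞)) :=
  (measurable_from_top (f := fun n : ℕ => (n : ℝ≥0∞))).comp (measurable_pi_apply x)

lemma mean_eval {ν : Measure (Site 1 → ℕ)} (hν : ∀ z, Measure.map (shift z) ν = ν) (x : Site 1) :
    ∫⁻ η, (η x : ℝ≥0∞) ∂ν = ∫⁻ η, (η 0 : ℝ≥0∞) ∂ν := by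
  conv_rhs => rw [← hν x, lintegral_map (meas_eval 0) (measurable_shift x)]
  simp [shift]

lemma max_ineq_N {ν : Measure (Site 1 → ℕ)} [IsProbabilityMeasure ν]
    (hν : ∀ z, Measure.map (shift z) ν = ν) {ρ : ℝ} (hρ : 0 ≤ ρ)
    (hmean : ∫⁻ η, (η 0 : ℝ≥0∞) ∂ν = ENNReal.ofReal ρ) (m N : ℕ) (d : ℤ) :
    ν {η | Bad m N (fun i => η (st (d * (i + 1)))) 0} ≤ ENNReal.ofReal (m * ρ) := by
  classical
  set E := {η : Site 1 → ℕ | Bad m N (fun i => η (st (d * (i + 1)))) 0} with hE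
  have hEm : MeasurableSet E := by
    have : E = ⋃ n ∈ Finset.range (N + 1), {η : Site 1 → ℕ |
        n < m * ∑ i ∈ Finset.range n, η (st (d * (i + 1)))} := by
      ext η
      simp [hE, Bad]
    rw [this]
    refine Finset.measurableSet_biUnion _ fun n _ => ?_
    refine measurableSet_lt measurable_const ?_
    refine Measurable.const_mul ?_ _
    exact Finset.measurable_sum _ fun i _ => measurable_pi_apply _
  have hsh : ∀ k : ℕ, ν {η | Bad m N (fun i => η (st (d * (i + 1)))) k} = ν E := by
    intro k
    conv_rhs => rw [← hν (st (d * k)), Measure.map_apply (measurable_shift _) hEm]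
    congr 1
    ext η
    simp only [hE, Bad, shift, Set.mem_preimage, Set.mem_ofPred_eq, st_add]
    simp only [st]
    have : ∀ i : ℕ, d * (((k + i : ℕ) : ℤ) + 1) = d * (((0 + i : ℕ) : ℤ) + 1) + d * k := by
      intro i; push_cast; ring
    simp only [this]
  have hmk : ∀ k : ℕ, MeasurableSet {η : Site 1 → ℕ | Bad m N (fun i => η (st (d * (i + 1)))) k} := by
    intro k
    have : {η : Site 1 → ℕ | Bad m N (fun i => η (st (d * (i + 1)))) k} =
       ⋃ n ∈ Finset.range (N + 1), {η : Site 1 → ℕ |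
        n < m * ∑ i ∈ Finset.range n, η (st (d * (((k + i : ℕ) : ℤ) + 1)))} := by
      ext η
      simp [Bad]
    rw [this]
    refine Finset.measurableSet_biUnion _ fun n _ => ?_
    refine measurableSet_lt measurable_const ?_
    refine Measurable.const_mul ?_ _
    exact Finset.measurable_sum _ fun i _ => measurable_pi_apply _
  have key : ∀ M : ℕ, (M : ℝ≥0∞) * ν E ≤ m * ((M + N : ℕ) * ENNReal.ofReal ρ) := by
    intro M
    have h1 : ∀ η : Site 1 → ℕ, ∑ k ∈ Finset.range M,
        ({η : Site 1 → ℕ | Bad m N (fun i => η (st (d * (i + 1)))) k}).indicator 1 η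
        ≤ (m : ℝ≥0∞) * ∑ i ∈ Finset.range (M + N), (η (st (d * (i + 1))) : ℝ≥0∞) := by
      intro η
      have := greedy m N (fun i => η (st (d * (i + 1)))) M M 0 (by simp)
      have h2 : ∑ k ∈ Finset.range M,
        ({η : Site 1 → ℕ | Bad m N (fun i => η (st (d * (i + 1)))) k}).indicator (1 : (Site 1 → ℕ) → ℝ≥0∞) η =
        ((((Finset.Ico 0 M).filter (Bad m N fun i => η (st (d * (i + 1))))).card : ℕ) : ℝ≥0∞) := by
        rw [Finset.card_filter]
        push_cast
        rw [Finset.range_eq_Ico]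
        refine Finset.sum_congr rfl fun k _ => ?_
        simp [Set.indicator_apply]
      rw [h2]
      rw [Finset.range_eq_Ico]
      exact_mod_cast this
    have h3 := lintegral_mono (μ := ν) h1
    rw [lintegral_finsetSum _ (fun k _ => measurable_one.indicator (hmk k)),
      lintegral_const_mul _ (Finset.measurable_sum _ fun i _ => meas_eval _),
      lintegral_finsetSum _ (fun k _ => meas_eval _)] at h3
    simp only [lintegral_indicator_one (hmk _), hsh, mean_eval hν (st _), hmean] at h3
    simpa using h3
  have hx : ν E ≠ ⊤ := measure_ne_top _ _
  have keyR : ∀ M : ℕ, (M : ℝ) * (ν E).toReal ≤ m * ((M + N) * ρ) := by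
    intro M
    have := ENNReal.toReal_mono (by
      refine ENNReal.mul_ne_top (by simp) (ENNReal.mul_ne_top (by simp) (by simp))) (key M)
    rw [ENNReal.toReal_mul, ENNReal.toReal_mul, ENNReal.toReal_mul, ENNReal.toReal_ofReal hρ,
      ENNReal.toReal_natCast, ENNReal.toReal_natCast, ENNReal.toReal_natCast] at this
    push_cast at this
    exact this
  rw [ENNReal.le_ofReal_iff_toReal_le hx (by positivity)]
  by_contra hc
  push Not at hc
  obtain ⟨M, hM⟩ := exists_nat_gt (m * (N * ρ) / ((ν E).toReal - m * ρ))
  have hpos : 0 < (ν E).toReal - m * ρ := by linarith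
  rw [div_lt_iff₀ hpos] at hM
  have := keyR M
  nlinarith

lemma max_ineq {ν : Measure (Site 1 → ℕ)} [IsProbabilityMeasure ν]
    (hν : ∀ z, Measure.map (shift z) ν = ν) {ρ : ℝ} (hρ : 0 ≤ ρ)
    (hmean : ∫⁻ η, (η 0 : ℝ≥0∞) ∂ν = ENNReal.ofReal ρ) (m : ℕ) (d : ℤ) :
    ν {η | ∃ n : ℕ, n < m * ∑ i ∈ Finset.range n, η (st (d * (i + 1)))} ≤
      ENNReal.ofReal (m * ρ) := by
  have : {η : Site 1 → ℕ | ∃ n : ℕ, n < m * ∑ i ∈ Finset.range n, η (st (d * (i + 1)))} =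
      ⋃ N : ℕ, {η | Bad m N (fun i => η (st (d * (i + 1)))) 0} := by
    ext η
    simp only [Set.mem_ofPred_eq, Set.mem_iUnion, Bad]
    constructor
    · rintro ⟨n, hn⟩; exact ⟨n, n, le_rfl, by simpa using hn⟩
    · rintro ⟨N, n, _, hn⟩; exact ⟨n, by simpa using hn⟩
  rw [this, Monotone.measure_iUnion]
  · exact iSup_le fun N => max_ineq_N hν hρ hmean m N d
  · intro N N' h η hη
    obtain ⟨n, hn, h'⟩ := hη
    exact ⟨n, hn.trans h, h'⟩

lemma good_pos {ν : Measure (Site 1 → ℕ)} [IsProbabilityMeasure ν]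
    (hν : ∀ z, Measure.map (shift z) ν = ν) {ρ : ℝ} (hρ : 0 ≤ ρ)
    (hmean : ∫⁻ η, (η 0 : ℝ≥0∞) ∂ν = ENNReal.ofReal ρ) (m : ℕ) (hm : ρ + 2 * (m * ρ) < 1) :
    ν {η | GoodEta m η} ≠ 0 := by
  intro h
  have sub : (Set.univ : Set (Site 1 → ℕ)) ⊆ {η | GoodEta m η} ∪ ({η | (1 : ℝ≥0∞) ≤ (η 0 : ℝ≥0∞)} ∪
      ({η | ∃ n : ℕ, n < m * ∑ i ∈ Finset.range n, η (st (1 * (i + 1)))} ∪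
       {η | ∃ n : ℕ, n < m * ∑ i ∈ Finset.range n, η (st ((-1) * (i + 1)))})) := by
    intro η _
    by_contra hc
    simp only [Set.mem_union, not_or, Set.mem_ofPred_eq, not_exists, not_lt] at hc
    obtain ⟨h1, h2, h3, h4⟩ := hc
    refine h1 ⟨?_, ?_, ?_⟩
    · have : ((η 0 : ℕ) : ℝ≥0∞) < 1 := not_le.1 h2
      have : η 0 < 1 := by exact_mod_cast this
      change η 0 = 0
      omega
    · intro n; simpa [SS] using h3 n
    · intro n; simpa [SS] using h4 n
  have h1 : ν {η | (1 : ℝ≥0∞) ≤ (η 0 : ℝ≥0∞)} ≤ ENNReal.ofReal ρ := by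
    have := mul_meas_ge_le_lintegral (μ := ν) (meas_eval 0) 1
    rw [hmean, one_mul] at this
    exact this
  have := (measure_mono sub).trans ((measure_union_le _ _).trans (add_le_add h.le
    ((measure_union_le _ _).trans (add_le_add h1 ((measure_union_le _ _).trans
      (add_le_add (max_ineq hν hρ hmean m 1) (max_ineq hν hρ hmean m (-1))))))))
  rw [measure_univ, zero_add, ← ENNReal.ofReal_add (by positivity) (by positivity),
    ← ENNReal.ofReal_add (by positivity) (by positivity), ENNReal.one_le_ofReal] at this
  linarith

end ARWp
namespace ARWp

lemma sum_Hh (J : ℤ → ℕ → Option ℤ) (η u : ℤ → ℕ) (a : ℤ) (n : ℕ) :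
    ∑ i ∈ Finset.range n, Hh J η u (a + i) = ∑ i ∈ Finset.range n, (η (a + i) : ℤ)
      + cR J (a - 1) (u (a - 1)) - cL J a (u a)
      + cL J (a + n) (u (a + n)) - cR J (a + n - 1) (u (a + n - 1)) := by
  induction n with
  | zero => simp
  | succ n ih =>
    rw [Finset.sum_range_succ, ih, Finset.sum_range_succ]
    unfold Hh
    have e1 : a + ((n + 1 : ℕ) : ℤ) = a + n + 1 := by push_cast; ring
    have e2 : a + ((n + 1 : ℕ) : ℤ) - 1 = a + n := by push_cast; ring
    rw [e2, e1]
    ring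

lemma count_box {L : ℕ} {l : List (Site 1)} (h : ∀ x ∈ l, x ∈ box L) :
    l.length = ∑ x ∈ box L, l.count x := by
  classical
  induction l with
  | nil => simp
  | cons a l ih =>
    simp only [List.length_cons, List.count_cons]
    rw [Finset.sum_add_distrib, ih fun x hx => h x (by simp [hx])]
    simp [h a (by simp)]

lemma legal_mem {V : Finset (Site 1)} {I : Stacks 1} (l : List (Site 1)) : ∀ s : State 1,
    Legal V I s l → ∀ x ∈ l, x ∈ V := by
  induction l with
  | nil => intro s _ x hx; simp at hx
  | cons a l ih =>
    intro s h x hx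
    rcases List.mem_cons.1 hx with rfl | hx
    · exact h.1
    · exact ih _ h.2.2 x hx

lemma boundary_odom {I : Stacks 1} {η : Site 1 → ℕ} (hN : NN (Jof I)) (hR : Rich (Jof I))
    (hη : ∀ x, 2 ≤ η x) (L : ℕ) : (L : ℕ∞) ≤ odomAt L I η ∨ (L : ℕ∞) ≤ odomAt (-L) I η := by
  classical
  by_cases htop : ∃ x, odomAt x I η = ⊤
  · obtain ⟨x, hx⟩ := htop
    left
    rw [odom_all hN hR x L hx]; exact le_top
  push Not at htop
  have hbd : ∀ l, Legal (box L) I (initState 1 (box L) η) l →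
      l.length ≤ ∑ x ∈ box L, (odomAt (x 0) I η).toNat := by
    intro l hl
    rw [count_box (legal_mem l _ hl)]
    refine Finset.sum_le_sum fun x _ => ?_
    have := le_odomAt (x := x 0) hl
    rw [st_eta, ← ENat.natCast_toNat (htop (x 0))] at this
    exact_mod_cast this
  set p : ℕ → Prop := fun n => ∃ l, Legal (box L) I (initState 1 (box L) η) l ∧ l.length = n with hp
  obtain ⟨l, hl, hlen⟩ : p (Nat.findGreatest p (∑ x ∈ box L, (odomAt (x 0) I η).toNat)) :=
    Nat.findGreatest_spec (P := p) (Nat.zero_le _) ⟨[], trivial, rfl⟩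
  have hmax : ∀ l', Legal (box L) I (initState 1 (box L) η) l' → l'.length ≤ l.length := by
    intro l' hl'
    rw [hlen]
    exact Nat.le_findGreatest (hbd l' hl') ⟨l', hl', rfl⟩
  set s := run (box L) I (initState 1 (box L) η) l with hs
  have hinv : LInv (box L) I η s := LInv_run hN l _ (LInv_init _ _ _) hl
  have hst : ∀ x ∈ box L, cnt (s.1 x) ≤ 1 := by
    intro x hx
    have h0 : numActive (s.1 x) = 0 := by
      by_contra hc
      have := hmax (l ++ [x]) ((legal_append l [x] _).2 ⟨hl, hx, by
        have : 1 ≤ numActive (s.1 x) := by omega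
        exact this, trivial⟩)
      simp at this
    cases h : s.1 x with
    | active n => rw [h] at h0; simp only [numActive] at h0; simp [cnt, h0]
    | sleeping => simp [cnt]
  have hsum := sum_Hh (Jof I) (fun z => η (st z)) (fun z => s.2 (st z)) (-(L : ℤ)) (2 * L + 1)
  have hle : ∑ i ∈ Finset.range (2 * L + 1),
      Hh (Jof I) (fun z => η (st z)) (fun z => s.2 (st z)) (-(L : ℤ) + i) ≤ 2 * L + 1 := by
    have : ∑ i ∈ Finset.range (2 * L + 1),
      Hh (Jof I) (fun z => η (st z)) (fun z => s.2 (st z)) (-(L : ℤ) + i) ≤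
        ∑ i ∈ Finset.range (2 * L + 1), (1 : ℤ) := by
      refine Finset.sum_le_sum fun i hi => ?_
      have hi' := Finset.mem_range.1 hi
      have hb : st (-(L : ℤ) + i) ∈ box L := mem_box.2 (by omega)
      rw [← hinv.mass _ hb]
      exact_mod_cast hst _ hb
    simpa using this
  have hge : (2 * (2 * L + 1) : ℤ) ≤ ∑ i ∈ Finset.range (2 * L + 1), (η (st (-(L : ℤ) + i)) : ℤ) := by
    have : ∑ i ∈ Finset.range (2 * L + 1), (2 : ℤ) ≤
        ∑ i ∈ Finset.range (2 * L + 1), (η (st (-(L : ℤ) + i)) : ℤ) :=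
      Finset.sum_le_sum fun i _ => by exact_mod_cast hη _
    simp at this
    linarith
  have o1 : s.2 (st (-(L : ℤ) - 1)) = 0 := hinv.out _ (by rw [mem_box]; omega)
  have e1 : -(L : ℤ) + ((2 * L + 1 : ℕ) : ℤ) - 1 = L := by push_cast; ring
  have h1 := cR_le (Jof I) (L : ℤ) (s.2 (st L))
  have h2 := cL_le (Jof I) (-(L : ℤ)) (s.2 (st (-(L : ℤ))))
  simp only [o1, cR_zero, e1] at hsum
  have c1 : s.2 (st L) = l.count (st L) := by rw [hs, run_snd]; simp [initState]
  have c2 : s.2 (st (-(L : ℤ))) = l.count (st (-(L : ℤ))) := by rw [hs, run_snd]; simp [initState]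
  by_cases c : L ≤ s.2 (st L)
  · left
    rw [c1] at c
    exact le_trans (by exact_mod_cast c) (le_odomAt hl)
  · right
    have c' : L ≤ s.2 (st (-(L : ℤ))) := by
      push_cast at hsum
      omega
    rw [c2] at c'
    exact le_trans (by exact_mod_cast c') (le_odomAt hl)

lemma not_fixates {ε : ℝ} (h0 : 0 < ε) {ν : Measure (Site 1 → ℕ)} [IsProbabilityMeasure ν]
    (hν : ∀ z, Measure.map (shift z) ν = ν) (h2 : ∀ᵐ η ∂ν, ∀ x, 2 ≤ η x) :
    ¬ Fixates 1 (ssrwStep 1) (ε ^ 2) ν := by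
  intro hfix
  unfold Fixates at hfix
  rw [stackLaw_eq h0] at hfix
  have := mu_prob h0
  set P := ν.prod (mu ε) with hP
  have hA0 : P {p | odomAt 0 p.2 p.1 = ⊤} = 0 := by
    rw [hP, Measure.measure_prod_null (meas_top 0)]
    filter_upwards [hfix] with η h
    rw [ae_iff] at h
    simp only [ne_eq, not_not] at h
    exact h
  have heq : ∀ (x : ℤ) (n : ℕ), P {p | (n : ℕ∞) ≤ odomAt x p.2 p.1} =
      P {p | (n : ℕ∞) ≤ odomAt 0 p.2 p.1} := by
    intro x n
    have mp := TT_mp h0 hν (st x)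
    rw [← mp.measure_preimage (meas_le_odom 0 n).nullMeasurableSet]
    congr 1
    ext p
    simp only [Set.mem_preimage, Set.mem_ofPred_eq, TT, odomAt_sh]
    simp [st]
  have hhalf : ∀ n : ℕ, (1 : ℝ≥0∞) / 2 ≤ P {p | (n : ℕ∞) ≤ odomAt 0 p.2 p.1} := by
    intro n
    have hone : 1 ≤ P ({p | (n : ℕ∞) ≤ odomAt n p.2 p.1} ∪ {p | (n : ℕ∞) ≤ odomAt (-n) p.2 p.1}) := by
      have h3 : ∀ᵐ p ∂P, ∀ x, 2 ≤ p.1 x := Measure.quasiMeasurePreserving_fst.ae h2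
      have h4 : ∀ᵐ p ∂P, NN (Jof p.2) := Measure.quasiMeasurePreserving_snd.ae (mu_NN h0)
      have h5 : ∀ᵐ p ∂P, Rich (Jof p.2) := Measure.quasiMeasurePreserving_snd.ae (mu_Rich h0)
      rw [← measure_univ (μ := P)]
      refine measure_mono_ae ?_
      filter_upwards [h3, h4, h5] with p a b c _
      exact boundary_odom b c a n
    have h3 := hone.trans (measure_union_le _ _)
    rw [heq n, heq (-n), ← two_mul] at h3
    exact ENNReal.div_le_of_le_mul' h3
  have hlim : P {p | odomAt 0 p.2 p.1 = ⊤} = ⨅ n : ℕ, P {p | (n : ℕ∞) ≤ odomAt 0 p.2 p.1} := by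
    have : {p : (Site 1 → ℕ) × Stacks 1 | odomAt 0 p.2 p.1 = ⊤} =
      ⋂ n : ℕ, {p : (Site 1 → ℕ) × Stacks 1 | (n : ℕ∞) ≤ odomAt 0 p.2 p.1} := by
      ext p
      simp only [Set.mem_ofPred_eq, Set.mem_iInter]
      constructor
      · intro h n; rw [h]; exact le_top
      · intro h; exact ENat.eq_top_iff_forall_ge.2 h
    rw [this]
    refine Antitone.measure_iInter ?_ (fun n => (meas_le_odom 0 n).nullMeasurableSet) ⟨0, measure_ne_top _ _⟩
    intro a b hab p hp
    have hp' : (b : ℕ∞) ≤ odomAt 0 p.2 p.1 := hp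
    exact le_trans (by exact_mod_cast hab) hp'
  have := le_iInf hhalf
  rw [← hlim, hA0] at this
  simp at this

end ARWp
namespace ARWp

open Classical in
/-- quasi-periodic configuration -/
noncomputable def gq (k : ℕ) (f : ℝ) (u : UnitAddCircle) : Site 1 → ℕ := fun x =>
  k + if u + (x 0) • ((Real.sqrt 2 : ℝ) : UnitAddCircle) ∈ Metric.closedBall (0 : UnitAddCircle) (f / 2)
    then 1 else 0

lemma gq_shift (k : ℕ) (f : ℝ) (u : UnitAddCircle) (z : Site 1) :
    shift z (gq k f u) = gq k f (u + (z 0) • ((Real.sqrt 2 : ℝ) : UnitAddCircle)) := by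
  funext x
  have : u + (z 0) • ((Real.sqrt 2 : ℝ) : UnitAddCircle) + (x 0) • ((Real.sqrt 2 : ℝ) : UnitAddCircle)
    = u + ((x + z) 0) • ((Real.sqrt 2 : ℝ) : UnitAddCircle) := by
    rw [Pi.add_apply, add_zsmul, add_comm ((x 0) • _), add_assoc]
  have h2 := congrArg (fun w : UnitAddCircle => k + @ite ℕ (w ∈ Metric.closedBall (0 : UnitAddCircle) (f / 2))
    (Classical.propDecidable _) 1 0) this
  exact h2.symm

lemma gq_meas (k : ℕ) (f : ℝ) : Measurable (gq k f) := by
  refine measurable_pi_lambda _ fun x => ?_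
  refine Measurable.const_add ?_ _
  refine Measurable.ite ?_ measurable_const measurable_const
  exact (measurable_add_const _) (Metric.isClosed_closedBall.measurableSet)

lemma exists_erg (ρ : ℝ) (hρ : 2 ≤ ρ) : ∃ ν : Measure (Site 1 → ℕ), IsProbabilityMeasure ν ∧
    IsTransErgodic ν ∧ ∫⁻ η, (η 0 : ℝ≥0∞) ∂ν = ENNReal.ofReal ρ ∧ ∀ᵐ η ∂ν, ∀ x, 2 ≤ η x := by
  have hvol : IsProbabilityMeasure (volume : Measure UnitAddCircle) :=
    ⟨UnitAddCircle.measure_univ⟩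
  set k := ⌊ρ⌋₊ with hk
  set f := ρ - k with hf
  have hk2 : 2 ≤ k := Nat.le_floor (by exact_mod_cast hρ)
  have hf0 : 0 ≤ f := by have := Nat.floor_le (show 0 ≤ ρ by linarith); linarith
  have hf1 : f < 1 := by have := Nat.lt_floor_add_one ρ; linarith
  have hgm := gq_meas k f
  refine ⟨(volume : Measure UnitAddCircle).map (gq k f),
    Measure.isProbabilityMeasure_map hgm.aemeasurable, ⟨?_, ?_⟩, ?_, ?_⟩
  · intro z
    rw [Measure.map_map (measurable_shift z) hgm]
    have e : shift z ∘ gq k f = gq k f ∘ (· + (z 0) • ((Real.sqrt 2 : ℝ) : UnitAddCircle)) := by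
      funext u; exact gq_shift k f u z
    rw [e, ← Measure.map_map hgm (measurable_add_const _),
      (measurePreserving_add_right (volume : Measure UnitAddCircle) _).map_eq]
  · intro s hs hinv
    rw [Measure.map_apply hgm hs]
    have herg : Ergodic (· + ((Real.sqrt 2 : ℝ) : UnitAddCircle)) volume := by
      rw [AddCircle.ergodic_add_right, ← AddCircle.denseRange_zsmul_iff,
        AddCircle.denseRange_zsmul_coe_iff, div_one]
      exact irrational_sqrt_two
    refine herg.toPreErgodic.prob_eq_zero_or_one (hgm hs) ?_
    conv_rhs => rw [← hinv (st 1)]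
    ext u
    simp only [Set.mem_preimage, gq_shift]
    simp [st]
  · rw [lintegral_map (meas_eval 0) hgm]
    have : ∀ u, ((gq k f u 0 : ℕ) : ℝ≥0∞) = k + (Metric.closedBall (0 : UnitAddCircle) (f / 2)).indicator 1 u := by
      intro u
      by_cases hu : u ∈ Metric.closedBall (0 : UnitAddCircle) (f / 2)
      · rw [Set.indicator_of_mem hu]
        have : gq k f u 0 = k + 1 := by
          have e : u + ((0 : Site 1) 0) • ((Real.sqrt 2 : ℝ) : UnitAddCircle) = u := by
            rw [Pi.zero_apply, zero_zsmul, add_zero]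
          unfold gq
          congr 1
          exact if_pos (by rw [e]; exact hu)
        rw [this]; simp
      · rw [Set.indicator_of_notMem hu]
        have : gq k f u 0 = k + 0 := by
          have e : u + ((0 : Site 1) 0) • ((Real.sqrt 2 : ℝ) : UnitAddCircle) = u := by
            rw [Pi.zero_apply, zero_zsmul, add_zero]
          unfold gq
          congr 1
          exact if_neg (by rw [e]; exact hu)
        rw [this]; simp
    simp only [this]
    rw [lintegral_add_left measurable_const,
      lintegral_indicator_one Metric.isClosed_closedBall.measurableSet, AddCircle.volume_closedBall]
    simp only [lintegral_const, measure_univ, mul_one]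
    rw [show 2 * (f / 2) = f by ring, min_eq_right hf1.le, ← ENNReal.ofReal_natCast,
      ← ENNReal.ofReal_add (by positivity) hf0]
    congr 1
    linarith
  · rw [ae_map_iff hgm.aemeasurable]
    · refine Eventually.of_forall fun u x => ?_
      simp only [gq]; omega
    · have : {η : Site 1 → ℕ | ∀ x, 2 ≤ η x} = ⋂ x, {η : Site 1 → ℕ | 2 ≤ η x} := by
        ext; simp
      rw [this]
      exact MeasurableSet.iInter fun x => measurableSet_le measurable_const (measurable_pi_apply x)

lemma crit_bdd {ε : ℝ} (h0 : 0 < ε) : BddAbove {ρ : ℝ | 0 ≤ ρ ∧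
    ∀ ν : Measure (Site 1 → ℕ), IsProbabilityMeasure ν → IsTransErgodic ν →
      (∫⁻ η, (η 0 : ℝ≥0∞) ∂ν) = ENNReal.ofReal ρ → Fixates 1 (ssrwStep 1) (ε ^ 2) ν} := by
  refine ⟨2, ?_⟩
  rintro ρ ⟨_, h⟩
  by_contra hc
  push Not at hc
  obtain ⟨ν, h1, h2, h3, h4⟩ := exists_erg ρ hc.le
  exact not_fixates h0 h2.1 h4 (h ν h1 h2 h3)

lemma crit_mem {ε : ℝ} (h0 : 0 < ε) (h1 : ε ≤ 1 / 2) : (1 / 240 * ε) ∈ {ρ : ℝ | 0 ≤ ρ ∧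
    ∀ ν : Measure (Site 1 → ℕ), IsProbabilityMeasure ν → IsTransErgodic ν →
      (∫⁻ η, (η 0 : ℝ≥0∞) ∂ν) = ENNReal.ofReal ρ → Fixates 1 (ssrwStep 1) (ε ^ 2) ν} := by
  refine ⟨by positivity, fun ν hP hE hmean => ?_⟩
  set q := ⌈2 / ε⌉₊ with hq
  have q1 : 2 / ε ≤ q := Nat.le_ceil _
  have q2 : (q : ℝ) < 2 / ε + 1 := Nat.ceil_lt_add_one (by positivity)
  rw [div_le_iff₀ h0] at q1
  have q3 : (q : ℝ) * ε < 2 + ε := by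
    have := mul_lt_mul_of_pos_right q2 h0
    rwa [add_mul, div_mul_cancel₀ _ h0.ne', one_mul] at this
  have hpow : (256 : ℝ) ≤ pE ε ^ (q * 8) := by
    have a := one_add_mul_le_pow (a := ε / 2) (by linarith) q
    have b : (1 + ε / 2) ^ q ≤ pE ε ^ q := pow_le_pow_left₀ (by positivity) (pE_ge h0 h1) q
    have c : (2 : ℝ) ≤ pE ε ^ q := by nlinarith
    rw [pow_mul]
    calc (256 : ℝ) = 2 ^ 8 := by norm_num
      _ ≤ _ := pow_le_pow_left₀ (by norm_num) c 8
  refine fixates_of h0 h1 hpow hE (good_pos hE.1 (ρ := 1 / 240 * ε) (by positivity) hmean (q * 8) ?_)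
  push_cast
  nlinarith

end ARWp

theorem arw_low_sleep_dim1_lower :
    ∃ c > (0 : ℝ), ∃ lam₀ : ℝ, 0 < lam₀ ∧ lam₀ < 1 ∧ ∀ lam : ℝ, 0 < lam → lam ≤ lam₀ →
      c * Real.sqrt lam ≤ critDensity 1 (ssrwStep 1) lam := by
  refine ⟨1 / 240, by norm_num, 1 / 4, by norm_num, by norm_num, fun lam h0 h1 => ?_⟩
  have hs0 : 0 < Real.sqrt lam := Real.sqrt_pos.2 h0
  have hs1 : Real.sqrt lam ≤ 1 / 2 := by
    rw [Real.sqrt_le_left (by norm_num)]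
    norm_num; linarith
  have hsq : Real.sqrt lam ^ 2 = lam := Real.sq_sqrt h0.le
  have hb := ARWp.crit_bdd hs0
  have hm := ARWp.crit_mem hs0 hs1
  rw [hsq] at hb hm
  exact le_csSup hb hm
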